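/- arXiv:1811.04322 — 9 statements merged into one kernel-verified Lean document; each statement's English description precedes it below -/
import Mathlib

section
/- Let Q(x) = (1/√(2π)) ∫_x^∞ e^{-u²/2} du be the standard Gaussian tail function. For every real x > 1, setting p = Q(x), one has √(8π + 2 − 2 ln p) − 2√(2π) < x < √(−ln(2π) − 2 ln p). -/
/-- The standard Gaussian tail function `Q(x) = (1/√(2π)) ∫_x^∞ e^{-u²/2} du`. -/
noncomputable def gaussQ (x : ℝ) : ℝ :=
  (Real.sqrt (2 * Real.pi))⁻¹ * ∫ u in Set.Ioi x, Real.exp (-u ^ 2 / 2)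

theorem integrable_exp_neg_sq_div_two :
    MeasureTheory.Integrable fun u : ℝ => Real.exp (-u ^ 2 / 2) := by
  refine (integrable_exp_neg_mul_sq (b := 1 / 2) (by norm_num)).congr (.of_forall fun u => ?_)
  dsimp only
  ring_nf

/-- The integral over `(x, x + 1)` already gives a lower bound for the Gaussian tail. -/
theorem exp_neg_add_one_sq_div_two_le_integral_Ioi {x : ℝ} (hx : 0 ≤ x) :
    Real.exp (-(x + 1) ^ 2 / 2) ≤ ∫ u in Set.Ioi x, Real.exp (-u ^ 2 / 2) := by
  have hint := integrable_exp_neg_sq_div_two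
  calc Real.exp (-(x + 1) ^ 2 / 2)
      = ∫ _ in Set.Ioc x (x + 1), Real.exp (-(x + 1) ^ 2 / 2) := by simp
    _ ≤ ∫ u in Set.Ioc x (x + 1), Real.exp (-u ^ 2 / 2) := by
        refine MeasureTheory.setIntegral_mono_on (by simp) hint.integrableOn
          measurableSet_Ioc fun u hu => Real.exp_le_exp.2 ?_
        nlinarith [hu.1, hu.2]
    _ ≤ ∫ u in Set.Ioi x, Real.exp (-u ^ 2 / 2) :=
        MeasureTheory.setIntegral_mono_set hint.integrableOn
          (.of_forall fun _ => (Real.exp_pos _).le) Set.Ioc_subset_Ioi_self.eventuallyLE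

/-- The upper Mills ratio bound for the Gaussian tail. -/
theorem mul_integral_Ioi_exp_neg_sq_div_two_le {x : ℝ} (hx : 0 ≤ x) :
    x * ∫ u in Set.Ioi x, Real.exp (-u ^ 2 / 2) ≤ Real.exp (-x ^ 2 / 2) := by
  have hderiv : ∀ u ∈ Set.Ici x, HasDerivAt (fun u : ℝ => -Real.exp (-u ^ 2 / 2))
      (u * Real.exp (-u ^ 2 / 2)) u := fun u _ => by
    convert! (((hasDerivAt_id u).pow 2).neg.div_const 2).exp.neg using 1
    simp
    ring
  have hnonneg : ∀ u ∈ Set.Ioi x, 0 ≤ u * Real.exp (-u ^ 2 / 2) := fun u hu =>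
    mul_nonneg (hx.trans (le_of_lt hu)) (Real.exp_pos _).le
  have hlim : Filter.Tendsto (fun u : ℝ => -Real.exp (-u ^ 2 / 2)) Filter.atTop (nhds 0) := by
    rw [← neg_zero]
    refine (Real.tendsto_exp_atBot.comp ?_).neg
    simp only [neg_div]
    exact Filter.tendsto_neg_atTop_atBot.comp
      ((Filter.tendsto_pow_atTop two_ne_zero).atTop_div_const two_pos)
  have hint := MeasureTheory.integrableOn_Ioi_deriv_of_nonneg' hderiv hnonneg hlim
  have heq := MeasureTheory.integral_Ioi_of_hasDerivAt_of_nonneg' hderiv hnonneg hlim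
  rw [zero_sub, neg_neg] at heq
  rw [← heq, ← MeasureTheory.integral_const_mul]
  exact MeasureTheory.setIntegral_mono_on
    (integrable_exp_neg_sq_div_two.integrableOn.const_mul x) hint measurableSet_Ioi
    fun u hu => mul_le_mul_of_nonneg_right (le_of_lt hu) (Real.exp_pos _).le

/-- For every real `x > 1`, setting `p = Q(x)`, one has
`√(8π + 2 − 2 ln p) − 2√(2π) < x < √(−ln(2π) − 2 ln p)`. -/
theorem gaussian_inverse_tail_bounds (x : ℝ) (hx : 1 < x) (p : ℝ) (hp : p = gaussQ x) :
    Real.sqrt (8 * Real.pi + 2 - 2 * Real.log p) - 2 * Real.sqrt (2 * Real.pi) < x ∧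
      x < Real.sqrt (-Real.log (2 * Real.pi) - 2 * Real.log p) := by
  have hx0 : 0 ≤ x := by linarith
  have hlower := exp_neg_add_one_sq_div_two_le_integral_Ioi hx0
  have hupper := mul_integral_Ioi_exp_neg_sq_div_two_le hx0
  rw [gaussQ] at hp
  set I := ∫ u in Set.Ioi x, Real.exp (-u ^ 2 / 2)
  set s := Real.sqrt (2 * Real.pi) with hs
  have hI : 0 < I := (Real.exp_pos _).trans_le hlower
  have hs_sq : s ^ 2 = 2 * Real.pi := Real.sq_sqrt (by positivity)
  have hs_two : 2 < s := Real.lt_sqrt_of_sq_lt (by linarith [Real.pi_gt_three])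
  have hlogp : Real.log p = Real.log I - Real.log s := by
    rw [hp, Real.log_mul (by positivity) hI.ne', Real.log_inv]
    ring
  have hlog_lower : -(x + 1) ^ 2 / 2 ≤ Real.log I := (Real.le_log_iff_exp_le hI).2 hlower
  have hlog_upper : Real.log I < -x ^ 2 / 2 := (Real.log_lt_iff_lt_exp hI).2 (by nlinarith)
  constructor
  · have hlogs : Real.log s ≤ s - 1 := Real.log_le_sub_one_of_pos (by linarith)
    rw [sub_lt_iff_lt_add, Real.sqrt_lt' (by linarith)]
    nlinarith [mul_pos (sub_pos.2 hx) (sub_pos.2 hs_two)]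
  · have hlog_two_pi : Real.log (2 * Real.pi) = 2 * Real.log s := by
      rw [← hs_sq, Real.log_pow]
      norm_num
    apply Real.lt_sqrt_of_sq_lt
    linarith
end

section
/- Let κ > 0 and let X be a Poisson random variable with mean κ. Then for every natural number k, Σ_{r=k}^∞ 2^{k−r−1} · Pr{X ≤ r} = Pr{X < k} + 2^k · e^{-κ/2} · Pr{Y ≥ k}, where Y is a Poisson random variable with mean κ/2. -/
/-- The probability mass function of a Poisson random variable with mean `κ`. -/
noncomputable def poissonPMF (κ : ℝ) (i : ℕ) : ℝ :=
  Real.exp (-κ) * κ ^ i / (Nat.factorial i)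

open Finset Filter Topology in
/-- Summation by parts for the partial sums of a nonnegative summable sequence against geometric
weights `2⁻¹, 2⁻², …`. -/
theorem hasSum_half_pow_mul_sum_range {a : ℕ → ℝ} (ha : ∀ i, 0 ≤ a i) (hs : Summable a) (k : ℕ) :
    HasSum (fun j : ℕ => (1 / 2 : ℝ) ^ (j + 1) * ∑ i ∈ range (j + k + 1), a i)
      (∑ i ∈ range k, a i + ∑' j : ℕ, (1 / 2 : ℝ) ^ j * a (j + k)) := by
  have partialSum : ∀ n : ℕ,
      ∑ j ∈ range n, (1 / 2 : ℝ) ^ (j + 1) * ∑ i ∈ range (j + k + 1), a i =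
        ∑ i ∈ range k, a i + ∑ j ∈ range n, (1 / 2 : ℝ) ^ j * a (j + k) -
          (1 / 2 : ℝ) ^ n * ∑ i ∈ range (n + k), a i := by
    intro n
    induction n with
    | zero => simp
    | succ n ih =>
      rw [sum_range_succ, ih, sum_range_succ (fun j => (1 / 2 : ℝ) ^ j * a (j + k)),
        show n + 1 + k = n + k + 1 by omega, sum_range_succ a (n + k)]
      ring
  have hsum : Summable fun j : ℕ => (1 / 2 : ℝ) ^ j * a (j + k) :=
    .of_nonneg_of_le (fun j => mul_nonneg (by positivity) (ha _))
      (fun j => mul_le_of_le_one_left (ha _) (pow_le_one₀ (by norm_num) (by norm_num)))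
      ((summable_nat_add_iff k).2 hs)
  rw [hasSum_iff_tendsto_nat_of_nonneg
    (fun j => mul_nonneg (by positivity) (sum_nonneg fun i _ => ha i))]
  simp_rw [partialSum]
  have hpow : Tendsto (fun n : ℕ => (1 / 2 : ℝ) ^ n) atTop (𝓝 0) :=
    tendsto_pow_atTop_nhds_zero_of_lt_one (by norm_num) (by norm_num)
  have hrem := hpow.mul (hs.hasSum.tendsto_sum_nat.comp (tendsto_add_atTop_nat k))
  simpa using (hsum.hasSum.tendsto_sum_nat.const_add (∑ i ∈ range k, a i)).sub hrem

theorem tsum_ite_le_eq_tsum_nat_add (f : ℕ → ℝ) (k : ℕ) :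
    ∑' r : ℕ, (if k ≤ r then f r else 0) = ∑' j : ℕ, f (j + k) := by
  rw [← (add_left_injective k).tsum_eq (f := fun r => if k ≤ r then f r else 0)]
  · simp
  · intro r hr
    have hkr : k ≤ r := by
      by_contra h
      simp [h] at hr
    exact ⟨r - k, Nat.sub_add_cancel hkr⟩

theorem poissonPMF_nonneg {κ : ℝ} (hκ : 0 ≤ κ) (i : ℕ) : 0 ≤ poissonPMF κ i := by
  unfold poissonPMF
  positivity

theorem summable_poissonPMF (κ : ℝ) : Summable (poissonPMF κ) := by
  exact ((Real.summable_pow_div_factorial κ).mul_left (Real.exp (-κ))).congr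
    fun _ => (mul_div_assoc _ _ _).symm

theorem half_pow_mul_poissonPMF (κ : ℝ) (i : ℕ) :
    (1 / 2 : ℝ) ^ i * poissonPMF κ i = Real.exp (-κ / 2) * poissonPMF (κ / 2) i := by
  have hexp : Real.exp (-κ) = Real.exp (-κ / 2) * Real.exp (-(κ / 2)) := by
    rw [← Real.exp_add]
    ring_nf
  rw [poissonPMF, poissonPMF, hexp, div_eq_mul_one_div κ 2, mul_pow]
  ring

/-- For `X ~ Poisson(κ)` and every natural `k`,
`Σ_{r=k}^∞ 2^{k−r−1}·Pr{X ≤ r} = Pr{X<k} + 2^k·e^{-κ/2}·Pr{Y≥k}` where `Y ~ Poisson(κ/2)`. -/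
theorem poisson_sum_identity_achievability (κ : ℝ) (hκ : 0 < κ) (k : ℕ) :
    (∑' r : ℕ, (if k ≤ r then
        (2 : ℝ) ^ ((k : ℤ) - (r : ℤ) - 1) * ∑ i ∈ Finset.range (r + 1), poissonPMF κ i
      else 0)) =
      (∑ i ∈ Finset.range k, poissonPMF κ i) +
        2 ^ k * Real.exp (-κ / 2) *
          ∑' i : ℕ, (if k ≤ i then poissonPMF (κ / 2) i else 0) := by
  rw [tsum_ite_le_eq_tsum_nat_add
      (fun r => (2 : ℝ) ^ ((k : ℤ) - (r : ℤ) - 1) * ∑ i ∈ Finset.range (r + 1), poissonPMF κ i),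
    tsum_ite_le_eq_tsum_nat_add, ← tsum_mul_left]
  have hweight (j : ℕ) : (2 : ℝ) ^ ((k : ℤ) - ((j + k : ℕ) : ℤ) - 1) = (1 / 2) ^ (j + 1) := by
    rw [show (k : ℤ) - ((j + k : ℕ) : ℤ) - 1 = -((j + 1 : ℕ) : ℤ) by push_cast; ring,
      zpow_neg, zpow_natCast, one_div, inv_pow]
  have hterm (j : ℕ) : 2 ^ k * Real.exp (-κ / 2) * poissonPMF (κ / 2) (j + k) =
      (1 / 2) ^ j * poissonPMF κ (j + k) := by
    rw [mul_assoc, ← half_pow_mul_poissonPMF, pow_add, one_div, inv_pow, inv_pow]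
    field_simp
  simp_rw [hweight, hterm]
  exact (hasSum_half_pow_mul_sum_range (poissonPMF_nonneg hκ.le) (summable_poissonPMF κ) k).tsum_eq
end

section
/- Let κ > 0 and let X be a Poisson random variable with mean κ. Then for every natural number k, E[ 1{X < k} · (1 − 2^{X−k}) ] = Pr{X < k} − 2^{-k} · e^{κ} · Pr{Z < k}, where Z is a Poisson random variable with mean 2κ. -/
/-- Exponential tilting by a factor of two turns the mass function of mean `κ` into that of
mean `2 * κ`, up to the normalising constant `exp κ`. -/
theorem poissonPMF_mul_two_pow (κ : ℝ) (i : ℕ) :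
    poissonPMF κ i * 2 ^ i = Real.exp κ * poissonPMF (2 * κ) i := by
  have h : Real.exp (-κ) = Real.exp κ * Real.exp (-(2 * κ)) := by
    rw [← Real.exp_add]
    ring_nf
  rw [poissonPMF, poissonPMF, h, mul_pow]
  ring

/-- For `X ~ Poisson(κ)` and every natural `k`,
`E[1{X<k}·(1 − 2^{X−k})] = Pr{X<k} − 2^{-k}·e^{κ}·Pr{Z<k}` where `Z ~ Poisson(2κ)`. -/
theorem poisson_expectation_identity_converse (κ : ℝ) (hκ : 0 < κ) (k : ℕ) :
    (∑' i : ℕ, poissonPMF κ i *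
        (if i < k then 1 - (2 : ℝ) ^ ((i : ℤ) - (k : ℤ)) else 0)) =
      (∑ i ∈ Finset.range k, poissonPMF κ i) -
        (2 : ℝ) ^ (-(k : ℤ)) * Real.exp κ * ∑ i ∈ Finset.range k, poissonPMF (2 * κ) i := by
  rw [tsum_eq_sum (s := Finset.range k) fun i hi => by
      rw [if_neg (by simpa using hi), mul_zero],
    Finset.mul_sum, ← Finset.sum_sub_distrib]
  refine Finset.sum_congr rfl fun i hi => ?_
  rw [if_pos (Finset.mem_range.mp hi), mul_assoc, ← poissonPMF_mul_two_pow, sub_eq_add_neg (i : ℤ),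
    zpow_add₀ two_ne_zero, zpow_natCast]
  ring
end

section
/- Let n be a positive integer, ε ∈ (0,1), κ = n(1−ε), p_e ∈ (0,1), and α = (√2/ε^{3/2})(1 + 2√(3/(εκ)))(√e − 1)(1−ε). For λ > 0 let P_λ(x) = Pr{X < x} where X is Poisson with mean λ. Suppose the real number M₁ > 1 satisfies 𝔓₁ + α√𝔓₁ = p_e, where 𝔓₁ = P_κ(log₂ M₁) + M₁ e^{-κ/2}(1 − P_{κ/2}(log₂ M₁)). Then Σ_{r=0}^{n} C(n,r) ε^{n−r} (1−ε)^{r} · 2^{-max(r − log₂(M₁ − 1), 0)} ≤ p_e. -/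
/-- `poissonCDF λ x = Pr{X < x}` for a Poisson random variable `X` with mean `λ`. -/
noncomputable def poissonCDF (l x : ℝ) : ℝ :=
  ∑' i : ℕ, if (i : ℝ) < x then Real.exp (-l) * l ^ i / (Nat.factorial i) else 0

/-- `e^{-nδ}` times the `r`-th term of the sum `∑ B(r)² / P(r)`, where `B` and `P` are the mass
functions of the binomial law with parameters `n`, `δ` and of the Poisson law with mean `n δ`. -/
noncomputable def chiSqWeight (n : ℕ) (δ : ℝ) (r : ℕ) : ℝ :=
  (n.choose r : ℝ) ^ 2 * (r.factorial : ℝ) / (n : ℝ) ^ r * δ ^ r * (1 - δ) ^ (2 * (n - r))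

/-- `1 + χ²(Bin(n, δ) ‖ Poisson(n δ))`. -/
noncomputable def chiSqSum (n : ℕ) (δ : ℝ) : ℝ :=
  Real.exp (n * δ) * ∑ r ∈ Finset.range (n + 1), chiSqWeight n δ r

theorem chiSqWeight_nonneg (n r : ℕ) {δ : ℝ} (h0 : 0 ≤ δ) : 0 ≤ chiSqWeight n δ r := by
  unfold chiSqWeight
  have : 0 ≤ (1 - δ) ^ (2 * (n - r)) := by rw [pow_mul]; positivity
  positivity

theorem chiSqWeight_succ {n r : ℕ} (hr : r < n) (δ : ℝ) :
    (1 - δ) ^ 2 * n * ((r + 1 : ℝ) * chiSqWeight n δ (r + 1)) =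
      δ * ((n - r : ℝ) ^ 2 * chiSqWeight n δ r) := by
  have hn : (n : ℝ) ≠ 0 := by exact_mod_cast (by omega : n ≠ 0)
  have hc : (n.choose (r + 1) : ℝ) * (r + 1) = n.choose r * (n - r) := by
    have h := Nat.choose_succ_right_eq n r
    rw [← Nat.cast_sub hr.le]
    exact_mod_cast h
  have he : 2 * (n - r) = 2 * (n - (r + 1)) + 2 := by omega
  unfold chiSqWeight
  rw [he, Nat.factorial_succ]
  push_cast
  calc _ = ((n.choose (r + 1) : ℝ) * (r + 1)) ^ 2 * (r.factorial : ℝ) * (n / (n : ℝ) ^ (r + 1))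
        * δ ^ (r + 1) * (1 - δ) ^ (2 * (n - (r + 1)) + 2) := by ring
    _ = _ := by
      have h : (n : ℝ) / (n : ℝ) ^ (r + 1) = 1 / (n : ℝ) ^ r := by field_simp; ring
      rw [hc, h]; ring

theorem sum_chiSqWeight_shift (n : ℕ) (δ : ℝ) (φ : ℕ → ℝ) :
    (1 - δ) ^ 2 * n * ∑ r ∈ Finset.range (n + 1), (r : ℝ) * φ r * chiSqWeight n δ r =
      δ * ∑ r ∈ Finset.range (n + 1), (n - r : ℝ) ^ 2 * φ (r + 1) * chiSqWeight n δ r := by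
  rw [Finset.sum_range_succ', Finset.sum_range_succ]
  simp only [Nat.cast_zero, zero_mul, add_zero, sub_self, ne_eq, OfNat.ofNat_ne_zero,
    not_false_eq_true, zero_pow]
  rw [Finset.mul_sum, Finset.mul_sum]
  refine Finset.sum_congr rfl fun r hr => ?_
  have h := chiSqWeight_succ (Finset.mem_range.1 hr) δ
  push_cast
  linear_combination φ (r + 1) * h

/-- The first moment of `chiSqWeight` about `n δ`, in terms of the second one. -/
theorem chiSqWeight_first_moment (n : ℕ) (δ : ℝ) :
    n * (1 - δ) * (1 + δ) * ∑ r ∈ Finset.range (n + 1), (r - n * δ : ℝ) * chiSqWeight n δ r =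
      δ * ∑ r ∈ Finset.range (n + 1), (r - n * δ : ℝ) ^ 2 * chiSqWeight n δ r := by
  have h := sum_chiSqWeight_shift n δ 1
  rw [Finset.mul_sum, Finset.mul_sum, ← sub_eq_zero, ← Finset.sum_sub_distrib] at h ⊢
  rw [← h]
  refine Finset.sum_congr rfl fun r _ => ?_
  simp only [Pi.one_apply]
  ring

theorem chiSqWeight_second_moment_le {n : ℕ} (hn : 0 < n) {δ : ℝ} (h0 : 0 ≤ δ) (h1 : δ < 1) :
    ∑ r ∈ Finset.range (n + 1), (r - n * δ : ℝ) ^ 2 * chiSqWeight n δ r ≤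
      n * δ * (1 - δ) * (1 + δ) * ∑ r ∈ Finset.range (n + 1), chiSqWeight n δ r := by
  have hfirst := chiSqWeight_first_moment n δ
  have hshift := sum_chiSqWeight_shift n δ fun r => (r - n * δ : ℝ)
  set m₀ := ∑ r ∈ Finset.range (n + 1), chiSqWeight n δ r
  set m₁ := ∑ r ∈ Finset.range (n + 1), (r - n * δ : ℝ) * chiSqWeight n δ r
  set m₂ := ∑ r ∈ Finset.range (n + 1), (r - n * δ : ℝ) ^ 2 * chiSqWeight n δ r
  set m₃ := ∑ r ∈ Finset.range (n + 1), (r - n * δ : ℝ) ^ 3 * chiSqWeight n δ r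
  have hm₂ : 0 ≤ m₂ := Finset.sum_nonneg fun r _ =>
    mul_nonneg (sq_nonneg _) (chiSqWeight_nonneg n r h0)
  have hm₃ : m₃ ≤ n * (1 - δ) * m₂ := by
    simp only [m₃, m₂, Finset.mul_sum]
    refine Finset.sum_le_sum fun r hr => ?_
    have hr' : (r : ℝ) ≤ n := by exact_mod_cast Nat.lt_succ_iff.1 (Finset.mem_range.1 hr)
    have hw := mul_nonneg (sq_nonneg (r - n * δ : ℝ)) (chiSqWeight_nonneg n r h0)
    nlinarith [mul_nonneg (sub_nonneg.2 hr') hw]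
  have hl : ∑ r ∈ Finset.range (n + 1), (r : ℝ) * (r - n * δ) * chiSqWeight n δ r =
      m₂ + n * δ * m₁ := by
    simp only [m₁, m₂, Finset.mul_sum, ← Finset.sum_add_distrib]
    exact Finset.sum_congr rfl fun r _ => by ring
  have hr : ∑ r ∈ Finset.range (n + 1),
      (n - r : ℝ) ^ 2 * (((r + 1 : ℕ) : ℝ) - n * δ) * chiSqWeight n δ r =
      m₃ + (1 - 2 * (n * (1 - δ))) * m₂ + ((n * (1 - δ)) ^ 2 - 2 * (n * (1 - δ))) * m₁
        + (n * (1 - δ)) ^ 2 * m₀ := by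
    simp only [m₀, m₁, m₂, m₃, Finset.mul_sum, ← Finset.sum_add_distrib]
    exact Finset.sum_congr rfl fun r _ => by push_cast; ring
  rw [hl, hr] at hshift
  have hε : 0 < 1 - δ := by linarith
  have hn1 : (1 : ℝ) ≤ n := by exact_mod_cast hn
  have h3 := mul_le_mul_of_nonneg_left hm₃ h0
  have key : (n * (1 - δ) - δ) * m₂ + 2 * δ * n * (1 - δ) * m₁ ≤
      δ * n ^ 2 * (1 - δ) ^ 2 * m₀ := by nlinarith
  have key2 : (1 - δ) * ((n * (1 + δ) - δ) * m₂) ≤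
      (1 - δ) * (δ * n ^ 2 * (1 - δ) * (1 + δ) * m₀) := by
    have := mul_le_mul_of_nonneg_left key (by linarith : 0 ≤ 1 + δ)
    linear_combination this - 2 * δ * hfirst
  have key3 := le_of_mul_le_mul_left key2 hε
  have key4 : n * m₂ ≤ n * (n * δ * (1 - δ) * (1 + δ) * m₀) := by
    nlinarith [mul_nonneg (mul_nonneg h0 (sub_nonneg.2 hn1)) hm₂]
  exact le_of_mul_le_mul_left key4 (by linarith)

theorem hasDerivAt_chiSqWeight (n r : ℕ) {δ : ℝ} (h0 : δ ≠ 0) (h1 : 1 - δ ≠ 0) (hr : r ≤ n) :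
    HasDerivAt (fun t => chiSqWeight n t r)
      ((r / δ - 2 * (n - r) / (1 - δ)) * chiSqWeight n δ r) δ := by
  unfold chiSqWeight
  have hp : ∀ (k : ℕ) (x : ℝ), x ≠ 0 → (k : ℝ) * x ^ (k - 1) = k / x * x ^ k := by
    intro k x hx
    rcases k with _ | k
    · simp
    · simp only [Nat.add_sub_cancel]
      field_simp
      ring
  have ha := (hasDerivAt_pow r δ).const_mul
    ((n.choose r : ℝ) ^ 2 * (r.factorial : ℝ) / (n : ℝ) ^ r)
  have hb := ((hasDerivAt_id δ).const_sub 1).fun_pow (2 * (n - r))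
  refine (ha.fun_mul hb).congr_deriv ?_
  simp only [id]
  rw [hp r δ h0, hp _ _ h1]
  push_cast [Nat.cast_sub hr]
  ring

theorem hasDerivAt_chiSqSum (n : ℕ) {δ : ℝ} (h0 : δ ≠ 0) (h1 : 1 - δ ≠ 0) :
    HasDerivAt (chiSqSum n) (Real.exp (n * δ) * ((1 + δ) / (δ * (1 - δ)) *
      ∑ r ∈ Finset.range (n + 1), (r - n * δ : ℝ) * chiSqWeight n δ r)) δ := by
  have hs : HasDerivAt (fun t => ∑ r ∈ Finset.range (n + 1), chiSqWeight n t r) _ δ :=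
    HasDerivAt.fun_sum fun r hr =>
      hasDerivAt_chiSqWeight n r h0 h1 (Nat.lt_succ_iff.1 (Finset.mem_range.1 hr))
  have he : HasDerivAt (fun t : ℝ => Real.exp (n * t)) (Real.exp (n * δ) * n) δ := by
    simpa using ((hasDerivAt_id δ).const_mul (n : ℝ)).exp
  refine (he.fun_mul hs).congr_deriv ?_
  rw [mul_assoc, ← mul_add]
  congr 1
  simp only [Finset.mul_sum, ← Finset.sum_add_distrib]
  refine Finset.sum_congr rfl fun r _ => ?_
  field_simp
  ring

theorem deriv_chiSqSum_le {n : ℕ} (hn : 0 < n) {δ : ℝ} (h0 : 0 < δ) (h1 : δ < 1) :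
    (1 - δ) * deriv (chiSqSum n) δ ≤ δ * (1 + δ) * chiSqSum n δ := by
  have hε : 0 < 1 - δ := by linarith
  have hn' : (0 : ℝ) < n := by exact_mod_cast hn
  rw [(hasDerivAt_chiSqSum n h0.ne' hε.ne').deriv, chiSqSum]
  have hf := chiSqWeight_first_moment n δ
  have hs := chiSqWeight_second_moment_le hn h0.le h1
  set m₀ := ∑ r ∈ Finset.range (n + 1), chiSqWeight n δ r
  set m₁ := ∑ r ∈ Finset.range (n + 1), (r - n * δ : ℝ) * chiSqWeight n δ r
  have h : n * (1 - δ) * (1 + δ) * m₁ ≤ n * (1 - δ) * (1 + δ) * (δ ^ 2 * m₀) := by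
    have := mul_le_mul_of_nonneg_left hs h0.le
    linarith
  have h' : m₁ ≤ δ ^ 2 * m₀ := le_of_mul_le_mul_left h (by positivity)
  calc _ = Real.exp (n * δ) * ((1 + δ) / δ * m₁) := by field_simp
    _ ≤ Real.exp (n * δ) * ((1 + δ) / δ * (δ ^ 2 * m₀)) := by gcongr
    _ = _ := by field_simp

theorem chiSqSum_zero (n : ℕ) : chiSqSum n 0 = 1 := by
  simp [chiSqSum, chiSqWeight, Finset.sum_range_succ']

theorem chiSqSum_nonneg (n : ℕ) {δ : ℝ} (h0 : 0 ≤ δ) : 0 ≤ chiSqSum n δ :=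
  mul_nonneg (Real.exp_pos _).le (Finset.sum_nonneg fun r _ => chiSqWeight_nonneg n r h0)

theorem continuous_chiSqSum (n : ℕ) : Continuous (chiSqSum n) := by
  unfold chiSqSum chiSqWeight
  fun_prop

theorem chiSqSum_le {n : ℕ} (hn : 0 < n) {δ : ℝ} (h0 : 0 ≤ δ) (h1 : δ < 1) :
    chiSqSum n δ ≤ 1 + δ ^ 2 / (2 * (1 - δ) ^ 3) := by
  have hD : ∀ t : ℝ, t < 1 → 0 < (1 - t) ^ 3 + t ^ 2 / 2 := fun t ht => by
    have : 0 < 1 - t := by linarith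
    positivity
  have hanti : AntitoneOn
      (fun t => chiSqSum n t * (1 - t) ^ 3 / ((1 - t) ^ 3 + t ^ 2 / 2)) (Set.Ico 0 1) := by
    have hderiv : ∀ t ∈ interior (Set.Ico (0 : ℝ) 1), HasDerivAt
        (fun t => chiSqSum n t * (1 - t) ^ 3 / ((1 - t) ^ 3 + t ^ 2 / 2))
        (((deriv (chiSqSum n) t * (1 - t) ^ 3 - chiSqSum n t * (3 * (1 - t) ^ 2)) *
          ((1 - t) ^ 3 + t ^ 2 / 2) - chiSqSum n t * (1 - t) ^ 3 * (-(3 * (1 - t) ^ 2) + t)) /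
          ((1 - t) ^ 3 + t ^ 2 / 2) ^ 2) t := by
      intro t ht
      rw [interior_Ico] at ht
      have hF : HasDerivAt (chiSqSum n) (deriv (chiSqSum n) t) t :=
        (hasDerivAt_chiSqSum n ht.1.ne' (sub_pos.2 ht.2).ne').differentiableAt.hasDerivAt
      have hc := ((hasDerivAt_id t).const_sub 1).fun_pow 3
      have hq := ((hasDerivAt_id t).fun_pow 2).div_const 2
      refine ((hF.fun_mul hc).fun_div (hc.fun_add hq) (hD t ht.2).ne').congr_deriv ?_
      simp
      ring
    refine antitoneOn_of_deriv_nonpos (convex_Ico 0 1) ?_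
      (fun t ht => (hderiv t ht).differentiableAt.differentiableWithinAt) ?_
    · refine ContinuousOn.div ?_ (by fun_prop) fun t ht => (hD t ht.2).ne'
      exact ((continuous_chiSqSum n).mul (by fun_prop)).continuousOn
    · intro t ht
      rw [(hderiv t ht).deriv]
      rw [interior_Ico] at ht
      obtain ⟨ht0, ht1⟩ := ht
      refine div_nonpos_of_nonpos_of_nonneg ?_ (sq_nonneg _)
      have hF := chiSqSum_nonneg n ht0.le
      have hF' := deriv_chiSqSum_le hn ht0 ht1
      have hε : 0 < 1 - t := by linarith
      have hpoly : (1 + t) * ((1 - t) ^ 3 + t ^ 2 / 2) ≤ 1 + t / 2 := by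
        have : (1 - t) ^ 2 ≤ 1 := by nlinarith
        nlinarith [mul_le_mul_of_nonneg_left this (by nlinarith : 0 ≤ (1 + t) * (1 - t)),
          mul_pos ht0 ht0, mul_pos (mul_pos ht0 ht0) hε]
      have hA := mul_le_mul_of_nonneg_left hF'
        (mul_pos (pow_pos hε 2) (hD t ht1)).le
      have hB := mul_le_mul_of_nonneg_left hpoly
        (mul_nonneg (mul_nonneg (pow_pos hε 2).le hF) ht0.le)
      linear_combination hA + hB
  have h := hanti (Set.mem_Ico.2 ⟨le_rfl, one_pos⟩) (Set.mem_Ico.2 ⟨h0, h1⟩) h0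
  have hε : 0 < 1 - δ := by linarith
  simp only [chiSqSum_zero] at h
  norm_num at h
  rw [div_le_one (hD δ h1)] at h
  rw [← le_div_iff₀ (by positivity)] at h
  refine h.trans (le_of_eq ?_)
  field_simp

/-- A form of the Cauchy-Schwarz inequality: expectations of a `[0, 1]`-valued function under two
measures differ by at most the root of their `χ²` divergence times the root of one of them. -/
theorem sum_mul_le_add_sqrt_chiSq {ι : Type*} (s : Finset ι) (b p g : ι → ℝ)
    (hp : ∀ i ∈ s, 0 < p i) (hg0 : ∀ i ∈ s, 0 ≤ g i) (hg1 : ∀ i ∈ s, g i ≤ 1) :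
    ∑ i ∈ s, b i * g i ≤ ∑ i ∈ s, p i * g i +
      Real.sqrt (∑ i ∈ s, (b i - p i) ^ 2 / p i) * Real.sqrt (∑ i ∈ s, p i * g i) := by
  have hcs := Real.sum_mul_le_sqrt_mul_sqrt s (fun i => (b i - p i) / Real.sqrt (p i))
    (fun i => Real.sqrt (p i) * g i)
  have h1 : ∑ i ∈ s, (b i - p i) / Real.sqrt (p i) * (Real.sqrt (p i) * g i) =
      ∑ i ∈ s, b i * g i - ∑ i ∈ s, p i * g i := by
    rw [← Finset.sum_sub_distrib]
    refine Finset.sum_congr rfl fun i hi => ?_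
    have := (Real.sqrt_pos.2 (hp i hi)).ne'
    field_simp
  have h2 : ∑ i ∈ s, ((b i - p i) / Real.sqrt (p i)) ^ 2 = ∑ i ∈ s, (b i - p i) ^ 2 / p i :=
    Finset.sum_congr rfl fun i hi => by rw [div_pow, Real.sq_sqrt (hp i hi).le]
  have h3 : ∑ i ∈ s, (Real.sqrt (p i) * g i) ^ 2 ≤ ∑ i ∈ s, p i * g i := by
    refine Finset.sum_le_sum fun i hi => ?_
    rw [mul_pow, Real.sq_sqrt (hp i hi).le]
    have := hp i hi
    have : g i ^ 2 ≤ g i := by nlinarith [hg0 i hi, hg1 i hi]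
    gcongr
  rw [h1, h2] at hcs
  have := mul_le_mul_of_nonneg_left (Real.sqrt_le_sqrt h3)
    (Real.sqrt_nonneg (∑ i ∈ s, (b i - p i) ^ 2 / p i))
  linarith

theorem hasSum_poisson (l : ℝ) :
    HasSum (fun i : ℕ => Real.exp (-l) * l ^ i / (Nat.factorial i)) 1 := by
  have h := (NormedSpace.expSeries_div_hasSum_exp l).mul_left (Real.exp (-l))
  rw [← Real.exp_eq_exp_ℝ, ← Real.exp_add] at h
  simpa [mul_div_assoc] using h

theorem sum_poisson_le_poissonCDF {l : ℝ} (hl : 0 ≤ l) (x : ℝ) (s : Finset ℕ) :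
    ∑ i ∈ s, (if (i : ℝ) < x then Real.exp (-l) * l ^ i / (Nat.factorial i) else 0) ≤
      poissonCDF l x := by
  have hnn : ∀ i : ℕ, 0 ≤ Real.exp (-l) * l ^ i / (Nat.factorial i) := fun i => by positivity
  refine Summable.sum_le_tsum s (fun i _ => by split_ifs <;> simp [hnn]) ?_
  refine (hasSum_poisson l).summable.of_nonneg_of_le (fun i => ?_) fun i => ?_ <;>
    split_ifs <;> simp [hnn]

theorem sum_poisson_le_one_sub_poissonCDF {l : ℝ} (hl : 0 ≤ l) (x : ℝ) (s : Finset ℕ) :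
    ∑ i ∈ s, (if (i : ℝ) < x then 0 else Real.exp (-l) * l ^ i / (Nat.factorial i)) ≤
      1 - poissonCDF l x := by
  have hnn : ∀ i : ℕ, 0 ≤ Real.exp (-l) * l ^ i / (Nat.factorial i) := fun i => by positivity
  have hs : Summable fun i : ℕ =>
      if (i : ℝ) < x then Real.exp (-l) * l ^ i / (Nat.factorial i) else 0 := by
    refine (hasSum_poisson l).summable.of_nonneg_of_le (fun i => ?_) fun i => ?_ <;>
      split_ifs <;> simp [hnn]
  have h := (hasSum_poisson l).sub hs.hasSum
  refine (Finset.sum_le_sum fun i _ => ?_).trans (sum_le_hasSum s (fun i _ => ?_) h) <;>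
    split_ifs <;> simp [hnn]

theorem chiSq_binomial_poisson_le {n : ℕ} (hn : 0 < n) {δ : ℝ} (h0 : 0 < δ) (h1 : δ < 1) :
    ∑ r ∈ Finset.range (n + 1), ((n.choose r : ℝ) * (1 - δ) ^ (n - r) * δ ^ r -
        Real.exp (-(n * δ)) * (n * δ) ^ r / (Nat.factorial r)) ^ 2 /
        (Real.exp (-(n * δ)) * (n * δ) ^ r / (Nat.factorial r)) ≤
      δ ^ 2 / (2 * (1 - δ) ^ 3) := by
  have hn' : (0 : ℝ) < n := by exact_mod_cast hn
  set b : ℕ → ℝ := fun r => (n.choose r : ℝ) * (1 - δ) ^ (n - r) * δ ^ r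
  set p : ℕ → ℝ := fun r => Real.exp (-(n * δ)) * (n * δ) ^ r / (Nat.factorial r)
  have hp : ∀ r, 0 < p r := fun r => by positivity
  have hbp : ∀ r, b r ^ 2 / p r = Real.exp (n * δ) * chiSqWeight n δ r := fun r => by
    simp only [b, p, chiSqWeight, Real.exp_neg, mul_pow, pow_mul']
    field_simp
  have hb : ∑ r ∈ Finset.range (n + 1), b r = 1 := by
    have h := add_pow δ (1 - δ) n
    rw [add_sub_cancel, one_pow] at h
    rw [h]
    exact Finset.sum_congr rfl fun r _ => by ring
  have hp1 : ∑ r ∈ Finset.range (n + 1), p r ≤ 1 :=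
    sum_le_hasSum _ (fun r _ => (hp r).le) (hasSum_poisson (n * δ))
  calc ∑ r ∈ Finset.range (n + 1), (b r - p r) ^ 2 / p r
      = ∑ r ∈ Finset.range (n + 1), (b r ^ 2 / p r - 2 * b r + p r) :=
        Finset.sum_congr rfl fun r _ => by
          have := (hp r).ne'
          field_simp
          ring
    _ = chiSqSum n δ - 2 + ∑ r ∈ Finset.range (n + 1), p r := by
        rw [Finset.sum_add_distrib, Finset.sum_sub_distrib, ← Finset.mul_sum, hb, chiSqSum,
          Finset.mul_sum]
        simp only [hbp, mul_one]
    _ ≤ _ := by linarith [chiSqSum_le hn h0.le h1]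

theorem two_rpow_neg_max_le {M : ℝ} (hM : 1 < M) (r : ℕ) :
    (2 : ℝ) ^ (-(max ((r : ℝ) - Real.logb 2 (M - 1)) 0)) ≤
      if (r : ℝ) < Real.logb 2 M then 1 else M / 2 ^ r := by
  split_ifs
  · exact Real.rpow_le_one_of_one_le_of_nonpos one_le_two (by simp)
  · calc (2 : ℝ) ^ (-(max ((r : ℝ) - Real.logb 2 (M - 1)) 0))
        ≤ 2 ^ (Real.logb 2 (M - 1) - r) := by
          refine Real.rpow_le_rpow_of_exponent_le one_le_two ?_
          linarith [le_max_left ((r : ℝ) - Real.logb 2 (M - 1)) 0]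
      _ = (M - 1) / 2 ^ r := by
          rw [Real.rpow_sub two_pos, Real.rpow_logb two_pos (by norm_num) (by linarith),
            Real.rpow_natCast]
      _ ≤ M / 2 ^ r := by gcongr; linarith

theorem sqrt_chiSq_le_coefficient {δ ε c : ℝ} (hδ : 0 ≤ δ) (hε : 0 < ε) (hc : 0 ≤ c) :
    Real.sqrt (δ ^ 2 / (2 * ε ^ 3)) ≤
      Real.sqrt 2 / ε ^ ((3 : ℝ) / 2) * (1 + 2 * c) * (Real.sqrt (Real.exp 1) - 1) * δ := by
  have he : (1 : ℝ) / 2 ≤ Real.sqrt (Real.exp 1) - 1 := by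
    have h := Real.add_one_le_exp (1 / 2 : ℝ)
    rw [Real.exp_half] at h
    linarith
  have hpow : (ε ^ ((3 : ℝ) / 2)) ^ 2 = ε ^ 3 := by
    rw [← Real.rpow_natCast, ← Real.rpow_mul hε.le, ← Real.rpow_natCast]
    norm_num
  have hpos : 0 < ε ^ ((3 : ℝ) / 2) := Real.rpow_pos_of_pos hε _
  calc Real.sqrt (δ ^ 2 / (2 * ε ^ 3))
      = Real.sqrt 2 / ε ^ ((3 : ℝ) / 2) * 1 * (1 / 2) * δ := by
        rw [Real.sqrt_eq_iff_mul_self_eq (by positivity) (by positivity), ← hpow]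
        have h2 : Real.sqrt 2 * Real.sqrt 2 = 2 := Real.mul_self_sqrt zero_le_two
        field_simp
        nlinarith
    _ ≤ _ := by gcongr; linarith

/-- Achievability half of the non-asymptotic coding bound for the low-capacity BEC:
if `M₁ > 1` satisfies `𝔓₁ + α√𝔓₁ = p_e`, then the RCU bound sum is at most `p_e`. -/
theorem bec_low_capacity_achievability (n : ℕ) (hn : 0 < n) (ε : ℝ) (hε0 : 0 < ε)
    (hε1 : ε < 1) (κ : ℝ) (hκ : κ = (n : ℝ) * (1 - ε)) (pe : ℝ) (hpe0 : 0 < pe)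
    (hpe1 : pe < 1) (α : ℝ)
    (hα : α = Real.sqrt 2 / ε ^ ((3 : ℝ) / 2) * (1 + 2 * Real.sqrt (3 / (ε * κ))) *
      (Real.sqrt (Real.exp 1) - 1) * (1 - ε))
    (M₁ : ℝ) (hM₁ : 1 < M₁) (P₁ : ℝ)
    (hP₁ : P₁ = poissonCDF κ (Real.logb 2 M₁) +
      M₁ * Real.exp (-κ / 2) * (1 - poissonCDF (κ / 2) (Real.logb 2 M₁)))
    (heq : P₁ + α * Real.sqrt P₁ = pe) :
    (∑ r ∈ Finset.range (n + 1), (n.choose r : ℝ) * ε ^ (n - r) * (1 - ε) ^ r *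
        (2 : ℝ) ^ (-(max ((r : ℝ) - Real.logb 2 (M₁ - 1)) 0))) ≤ pe := by
  have hδ0 : 0 < 1 - ε := by linarith
  have hn' : (0 : ℝ) < n := by exact_mod_cast hn
  have hκ0 : 0 < κ := hκ ▸ mul_pos hn' hδ0
  set s := Finset.range (n + 1)
  set g : ℕ → ℝ := fun r => if (r : ℝ) < Real.logb 2 M₁ then 1 else M₁ / 2 ^ r
  set p : ℕ → ℝ := fun r => Real.exp (-κ) * κ ^ r / (Nat.factorial r)
  set b : ℕ → ℝ := fun r => (n.choose r : ℝ) * ε ^ (n - r) * (1 - ε) ^ r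
  have hp : ∀ r, 0 < p r := fun r => by positivity
  have hg0 : ∀ r, 0 ≤ g r := fun r => by
    simp only [g]
    split_ifs <;> positivity
  have hg1 : ∀ r, g r ≤ 1 := fun r => by
    simp only [g]
    split_ifs with h
    · exact le_rfl
    · rw [not_lt, Real.logb_le_iff_le_rpow one_lt_two (by linarith), Real.rpow_natCast] at h
      exact (div_le_one (by positivity)).2 h
  have hpg : ∑ r ∈ s, p r * g r ≤ P₁ := by
    have h1 := sum_poisson_le_poissonCDF hκ0.le (Real.logb 2 M₁) s
    have h2 := mul_le_mul_of_nonneg_left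
      (sum_poisson_le_one_sub_poissonCDF (half_pos hκ0).le (Real.logb 2 M₁) s)
      (by positivity : 0 ≤ M₁ * Real.exp (-κ / 2))
    rw [hP₁]
    refine le_trans (le_of_eq ?_) (add_le_add h1 h2)
    rw [Finset.mul_sum, ← Finset.sum_add_distrib]
    refine Finset.sum_congr rfl fun r _ => ?_
    simp only [p, g]
    split_ifs
    · ring
    · have he : Real.exp (-κ) = Real.exp (-κ / 2) * Real.exp (-(κ / 2)) := by
        rw [← Real.exp_add]; ring_nf
      rw [he, div_pow]
      field_simp
      ring
  have hchi : ∑ r ∈ s, (b r - p r) ^ 2 / p r ≤ (1 - ε) ^ 2 / (2 * ε ^ 3) := by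
    have h := chiSq_binomial_poisson_le hn hδ0 (by linarith : 1 - ε < 1)
    rwa [sub_sub_cancel, ← hκ] at h
  have hα' : Real.sqrt ((1 - ε) ^ 2 / (2 * ε ^ 3)) ≤ α :=
    hα ▸ sqrt_chiSq_le_coefficient hδ0.le hε0 (Real.sqrt_nonneg _)
  calc ∑ r ∈ s, b r * (2 : ℝ) ^ (-(max ((r : ℝ) - Real.logb 2 (M₁ - 1)) 0))
      ≤ ∑ r ∈ s, b r * g r := Finset.sum_le_sum fun r _ =>
        mul_le_mul_of_nonneg_left (two_rpow_neg_max_le hM₁ r) (by positivity)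
    _ ≤ ∑ r ∈ s, p r * g r +
          Real.sqrt (∑ r ∈ s, (b r - p r) ^ 2 / p r) * Real.sqrt (∑ r ∈ s, p r * g r) :=
        sum_mul_le_add_sqrt_chiSq s b p g (fun r _ => hp r) (fun r _ => hg0 r) fun r _ => hg1 r
    _ ≤ P₁ + α * Real.sqrt P₁ := by
        gcongr
        · exact (Real.sqrt_nonneg _).trans hα'
        · exact (Real.sqrt_le_sqrt hchi).trans hα'
    _ = pe := heq
end

section
/- Let n be a positive integer, ε ∈ (0,1), κ = n(1−ε), p_e ∈ (0,1), and α = (√2/ε^{3/2})(1 + 2√(3/(εκ)))(√e − 1)(1−ε). For λ > 0 let P_λ(x) = Pr{X < x} where X is Poisson with mean λ. Suppose the real number M₂ > 1 satisfies 𝔓₂ ≥ 0 and 𝔓₂ − α√𝔓₂ − α√(P_κ(log₂ M₂)) = p_e, where 𝔓₂ = P_κ(log₂ M₂) − (e^{κ}/M₂) P_{2κ}(log₂ M₂). Then Σ_{0 ≤ r < log₂ M₂} C(n,r) ε^{n−r} (1−ε)^{r} · (1 − 2^{r}/M₂) ≥ p_e. -/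
open Polynomial Finset

/-- `∑_{l ≤ n} x^l / l! · (P⁽ˡ⁾(x))²`, the second moment under a Poisson law of mean `x`, up to the
factor `exp x`, of the sequence with binomial transform the Taylor coefficients of `P`. -/
noncomputable def derivSqSum (n : ℕ) (P : ℝ[X]) (x : ℝ) : ℝ :=
  ∑ l ∈ range (n + 1), x ^ l / (l.factorial : ℝ) * ((derivative^[l] P).eval x) ^ 2

lemma derivSqSum_nonneg (n : ℕ) (P : ℝ[X]) {x : ℝ} (hx : 0 ≤ x) : 0 ≤ derivSqSum n P x :=
  sum_nonneg fun _ _ => by positivity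

lemma derivSqSum_zero (n : ℕ) (P : ℝ[X]) : derivSqSum n P 0 = (P.eval 0) ^ 2 := by
  simp [derivSqSum, sum_range_succ']

lemma hasDerivAt_exp_mul_derivSqSum_add (n : ℕ) (P : ℝ[X]) (x : ℝ) :
    HasDerivAt (fun y => Real.exp y * derivSqSum n P y)
      (Real.exp x * (derivSqSum n (P + derivative P) x -
        x ^ n / (n.factorial : ℝ) * ((derivative^[n + 1] P).eval x) ^ 2)) x := by
  induction n with
  | zero =>
    have h := (Real.hasDerivAt_exp x).mul ((P.hasDerivAt x).pow 2)
    simp only [derivSqSum, zero_add, sum_range_one, pow_zero, Nat.factorial_zero, Nat.cast_one,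
      div_one, one_mul, Function.iterate_zero, id_eq, Function.iterate_one, eval_add]
    refine (h.congr_deriv ?_).congr_of_eventuallyEq (.of_forall fun y => ?_)
    · simp
      ring
    · simp
  | succ n ih =>
    have hP := (derivative^[n + 1] P).hasDerivAt x
    have h := ih.add ((Real.hasDerivAt_exp x).mul
      (((hasDerivAt_pow (n + 1) x).div_const ((n + 1).factorial : ℝ)).mul (hP.pow 2)))
    have e : (fun y => Real.exp y * derivSqSum (n + 1) P y) =
        (fun y => Real.exp y * derivSqSum n P y) + Real.exp *
          ((fun y => y ^ (n + 1) / ((n + 1).factorial : ℝ)) *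
            (fun y => (derivative^[n + 1] P).eval y) ^ 2) := by
      funext y
      simp only [derivSqSum, sum_range_succ _ (n + 1), Pi.add_apply, Pi.mul_apply, Pi.pow_apply]
      ring
    rw [e]
    refine h.congr_deriv ?_
    have e2 : derivSqSum (n + 1) (P + derivative P) x = derivSqSum n (P + derivative P) x +
        x ^ (n + 1) / ((n + 1).factorial : ℝ) *
          ((derivative^[n + 1] P).eval x + (derivative^[n + 1 + 1] P).eval x) ^ 2 := by
      simp only [derivSqSum, sum_range_succ _ (n + 1), iterate_map_add, eval_add]
      rw [Function.iterate_succ_apply derivative (n + 1) P]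
    rw [e2]
    rw [← Function.iterate_succ_apply' derivative (n + 1) P]
    simp only [Pi.mul_apply, Pi.pow_apply, Nat.factorial_succ, Nat.succ_eq_add_one, Nat.cast_mul,
      Nat.add_sub_cancel, Nat.cast_add, Nat.cast_one]
    have : (n.factorial : ℝ) ≠ 0 := by positivity
    have : (n : ℝ) + 1 ≠ 0 := by positivity
    field_simp
    push_cast
    ring

lemma hasDerivAt_exp_mul_derivSqSum {n : ℕ} {P : ℝ[X]} (hP : P.natDegree ≤ n) (x : ℝ) :
    HasDerivAt (fun y => Real.exp y * derivSqSum n P y)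
      (Real.exp x * derivSqSum n (P + derivative P) x) x := by
  refine (hasDerivAt_exp_mul_derivSqSum_add n P x).congr_deriv ?_
  rw [iterate_derivative_eq_zero (Nat.lt_succ_of_le hP)]
  simp

lemma natDegree_add_derivative_le {n : ℕ} {P : ℝ[X]} (hP : P.natDegree ≤ n) :
    (P + derivative P).natDegree ≤ n :=
  natDegree_add_le_of_degree_le hP ((natDegree_derivative_le P).trans (by omega))

lemma le_of_hasDerivAt_nonneg {f f' : ℝ → ℝ} (hf : ∀ x, HasDerivAt f (f' x) x)
    (hf' : ∀ x, 0 ≤ x → 0 ≤ f' x) {a b : ℝ} (ha : 0 ≤ a) (hab : a ≤ b) : f a ≤ f b := by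
  refine monotoneOn_of_deriv_nonneg (convex_Ici (0 : ℝ))
    (fun x _ => (hf x).continuousAt.continuousWithinAt)
    (fun x _ => (hf x).differentiableAt.differentiableWithinAt) (fun x hx => ?_) ha
    (ha.trans hab) hab
  rw [(hf x).deriv]
  exact hf' x (interior_subset hx)

/-- If `P(0) + P'(0) = 0`, then `(exp x · derivSqSum n P x - P(0)²) / x²` is nondecreasing. -/
lemma exp_mul_derivSqSum_scale_le {n : ℕ} {P : ℝ[X]} (hP : P.natDegree ≤ n)
    (h0 : (P + derivative P).eval 0 = 0) {c x : ℝ} (hc0 : 0 ≤ c) (hc1 : c ≤ 1) (hx : 0 ≤ x) :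
    Real.exp (c * x) * derivSqSum n P (c * x) - (P.eval 0) ^ 2 ≤
      c ^ 2 * (Real.exp x * derivSqSum n P x - (P.eval 0) ^ 2) := by
  have hP1 := natDegree_add_derivative_le hP
  have hP2 := natDegree_add_derivative_le hP1
  set P1 := P + derivative P
  set P2 := P1 + derivative P1
  have d0 := hasDerivAt_exp_mul_derivSqSum hP
  have d1 := hasDerivAt_exp_mul_derivSqSum hP1
  have d2 := hasDerivAt_exp_mul_derivSqSum hP2
  have hlin : ∀ t, HasDerivAt (fun y => c * y) c t := fun t => by
    simpa using (hasDerivAt_id t).const_mul c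
  have m2 : ∀ t, 0 ≤ t → Real.exp (c * t) * derivSqSum n P2 (c * t) ≤
      Real.exp t * derivSqSum n P2 t := fun t ht =>
    le_of_hasDerivAt_nonneg d2
      (fun y hy => mul_nonneg (Real.exp_pos y).le (derivSqSum_nonneg n _ hy))
      (mul_nonneg hc0 ht) (by nlinarith)
  have m1 : ∀ t, 0 ≤ t → Real.exp (c * t) * derivSqSum n P1 (c * t) ≤
      c * (Real.exp t * derivSqSum n P1 t) := fun t ht => by
    have h := le_of_hasDerivAt_nonneg
      (f := fun y => c * (Real.exp y * derivSqSum n P1 y) -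
        Real.exp (c * y) * derivSqSum n P1 (c * y))
      (fun y => ((d1 y).const_mul c).sub ((d1 (c * y)).comp y (hlin y)))
      (fun y hy => by nlinarith [mul_le_mul_of_nonneg_left (m2 y hy) hc0]) le_rfl ht
    simp [derivSqSum_zero, h0] at h
    linarith
  have h := le_of_hasDerivAt_nonneg
    (f := fun y => c ^ 2 * (Real.exp y * derivSqSum n P y) -
      Real.exp (c * y) * derivSqSum n P (c * y))
    (fun y => ((d0 y).const_mul (c ^ 2)).sub ((d0 (c * y)).comp y (hlin y)))
    (fun y hy => by nlinarith [mul_le_mul_of_nonneg_left (m1 y hy) hc0]) le_rfl hx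
  simp [derivSqSum_zero] at h
  linarith

/-- The Poisson probability mass function. -/
noncomputable def poissonMass (l : ℝ) (r : ℕ) : ℝ := Real.exp (-l) * l ^ r / (r.factorial : ℝ)

/-- The binomial probability mass function. -/
noncomputable def binomialMass (n : ℕ) (q : ℝ) (r : ℕ) : ℝ :=
  (n.choose r : ℝ) * (1 - q) ^ (n - r) * q ^ r

/-- The ratio of the binomial mass function to the Poisson mass function of the same mean. -/
noncomputable def binomialPoissonRatio (n : ℕ) (q : ℝ) (r : ℕ) : ℝ :=
  (n.descFactorial r : ℝ) / (n : ℝ) ^ r * (1 - q) ^ (n - r) * Real.exp (n * q)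

lemma poissonMass_nonneg {l : ℝ} (hl : 0 ≤ l) (r : ℕ) : 0 ≤ poissonMass l r := by
  unfold poissonMass; positivity

lemma poissonMass_mul_ratio {n : ℕ} (hn : 0 < n) (q : ℝ) (r : ℕ) :
    poissonMass (n * q) r * binomialPoissonRatio n q r = binomialMass n q r := by
  have hn' : (n : ℝ) ≠ 0 := by positivity
  have hr : (r.factorial : ℝ) ≠ 0 := by positivity
  rw [poissonMass, binomialPoissonRatio, binomialMass, Nat.descFactorial_eq_factorial_mul_choose,
    Real.exp_neg, mul_pow]
  have := (Real.exp_pos (n * q)).ne'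
  push_cast
  field_simp

lemma sum_poissonMass_le_one {l : ℝ} (hl : 0 ≤ l) (N : ℕ) :
    ∑ r ∈ range N, poissonMass l r ≤ 1 := by
  have h := Real.sum_le_exp_of_nonneg hl N
  have e : ∑ r ∈ range N, poissonMass l r =
      Real.exp (-l) * ∑ r ∈ range N, l ^ r / (r.factorial : ℝ) := by
    rw [mul_sum]; exact sum_congr rfl fun r _ => by rw [poissonMass, mul_div_assoc]
  rw [e]
  calc _ ≤ Real.exp (-l) * Real.exp l := by gcongr
    _ = 1 := by rw [← Real.exp_add]; simp

lemma sum_binomialMass {n N : ℕ} (h : n + 1 ≤ N) (q : ℝ) :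
    ∑ r ∈ range N, binomialMass n q r = 1 := by
  rw [← sum_subset (range_subset_range.2 h)]
  · have := add_pow q (1 - q) n
    rw [add_sub_cancel, one_pow] at this
    rw [this]
    exact sum_congr rfl fun r _ => by rw [binomialMass]; ring
  · intro r _ hr
    simp only [mem_range, not_lt] at hr
    simp [binomialMass, Nat.choose_eq_zero_of_lt (show n < r by omega)]

/-- The polynomial `(1 - X/n)^n`. -/
noncomputable def poissonKernelPoly (n : ℕ) : ℝ[X] := C ((-1 / (n : ℝ)) ^ n) * (X - C (n : ℝ)) ^ n

lemma iterate_derivative_poissonKernelPoly_sq {n : ℕ} (hn : 0 < n) (q : ℝ) {l : ℕ} (hl : l ≤ n) :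
    ((derivative^[l] (poissonKernelPoly n)).eval (n * q)) ^ 2 =
      ((n.descFactorial l : ℝ) / (n : ℝ) ^ l * (1 - q) ^ (n - l)) ^ 2 := by
  have hn' : (n : ℝ) ≠ 0 := by positivity
  rw [poissonKernelPoly, iterate_derivative_C_mul, iterate_derivative_X_sub_pow]
  simp only [eval_mul, eval_C, eval_pow, eval_sub, eval_X, nsmul_eq_mul, eval_natCast]
  have e : (n : ℝ) * q - n = -1 * (n * (1 - q)) := by ring
  obtain ⟨m, rfl⟩ := Nat.exists_eq_add_of_le hl
  rw [Nat.add_sub_cancel_left, e, mul_pow (-1 : ℝ), mul_pow _ (1 - q), div_pow]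
  simp only [mul_pow, div_pow, ← pow_mul, mul_comm _ 2]
  simp only [pow_mul, neg_one_sq, one_pow]
  field_simp
  ring

lemma exp_mul_derivSqSum_poissonKernelPoly {n : ℕ} (hn : 0 < n) (q : ℝ) :
    Real.exp (n * q) * derivSqSum n (poissonKernelPoly n) (n * q) =
      ∑ r ∈ range (n + 1), binomialMass n q r * binomialPoissonRatio n q r := by
  rw [derivSqSum, mul_sum]
  refine sum_congr rfl fun r hr => ?_
  rw [iterate_derivative_poissonKernelPoly_sq hn q (by simpa [Nat.lt_succ_iff] using hr),
    ← poissonMass_mul_ratio hn, poissonMass, binomialPoissonRatio, Real.exp_neg]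
  have := (Real.exp_pos (n * q)).ne'
  field_simp

lemma pow_div_factorial_le_floor {l : ℝ} (hl : 0 ≤ l) (m : ℕ) :
    l ^ m / (m.factorial : ℝ) ≤ l ^ ⌊l⌋₊ / (⌊l⌋₊.factorial : ℝ) := by
  have step : ∀ k : ℕ, l ^ (k + 1) / ((k + 1).factorial : ℝ) =
      l ^ k / (k.factorial : ℝ) * (l / (k + 1)) := fun k => by
    rw [Nat.factorial_succ]; push_cast; field_simp; ring
  rcases le_total m ⌊l⌋₊ with h | h
  · refine Nat.le_induction (P := fun k _ => k ≤ ⌊l⌋₊ → l ^ m / (m.factorial : ℝ) ≤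
      l ^ k / (k.factorial : ℝ)) (fun _ => le_rfl) (fun k _ ih hk => ?_) _ h le_rfl
    refine (ih (by omega)).trans ?_
    rw [step]
    refine le_mul_of_one_le_right (by positivity) ((one_le_div (by positivity)).2 ?_)
    exact_mod_cast (Nat.le_floor_iff hl).1 hk
  · refine Nat.le_induction (P := fun k _ => l ^ k / (k.factorial : ℝ) ≤
      l ^ ⌊l⌋₊ / (⌊l⌋₊.factorial : ℝ)) le_rfl (fun k hk ih => ?_) _ h
    refine le_trans ?_ ih
    rw [step]
    refine mul_le_of_le_one_right (by positivity) ((div_le_one (by positivity)).2 ?_)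
    exact_mod_cast (Nat.lt_floor_add_one l).le.trans (by exact_mod_cast Nat.succ_le_succ hk)

lemma factorial_eq_stirlingSeq {n : ℕ} (hn : 0 < n) :
    (n.factorial : ℝ) =
      Stirling.stirlingSeq n * (Real.sqrt n * Real.sqrt 2) * (n ^ n * Real.exp (-n)) := by
  have h1 : (0 : ℝ) < n := by positivity
  rw [Stirling.stirlingSeq, mul_comm (2 : ℝ), Real.sqrt_mul h1.le, div_pow, ← Real.exp_nat_mul,
    mul_one, Real.exp_neg]
  have := (Real.exp_pos n).ne'
  field_simp

lemma stirlingSeq_le {m n : ℕ} (hm : 0 < m) (h : m ≤ n) :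
    Stirling.stirlingSeq n ≤ Stirling.stirlingSeq m := by
  obtain ⟨a, rfl⟩ := Nat.exists_eq_succ_of_ne_zero hm.ne'
  obtain ⟨b, rfl⟩ := Nat.exists_eq_succ_of_ne_zero (hm.trans_le h).ne'
  exact Stirling.stirlingSeq'_antitone (Nat.le_of_succ_le_succ h)

lemma pow_mul_exp_neg_le {l : ℝ} {m : ℕ} (hl : 0 ≤ l) (hm : 0 < m) :
    l ^ m * Real.exp (-l) ≤ m ^ m * Real.exp (-m) := by
  have hm' : (0 : ℝ) < m := by positivity
  have h : (l / m) ^ m ≤ Real.exp (l - m) := by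
    calc (l / m) ^ m ≤ (Real.exp (l / m - 1)) ^ m := by
          gcongr; linarith [Real.add_one_le_exp (l / m - 1)]
      _ = _ := by rw [← Real.exp_nat_mul]; congr 1; field_simp
  rw [div_pow, div_le_iff₀ (by positivity)] at h
  calc l ^ m * Real.exp (-l) ≤ Real.exp (l - m) * m ^ m * Real.exp (-l) := by gcongr
    _ = m ^ m * (Real.exp (l - m) * Real.exp (-l)) := by ring
    _ = _ := by rw [← Real.exp_add]; congr 2; ring

lemma factorial_mul_exp_mul_poisson_le {n : ℕ} (hn : 0 < n) :
    (n.factorial : ℝ) * (Real.exp n / n ^ n) *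
      (((n : ℝ) / 4) ^ ⌊(n : ℝ) / 4⌋₊ / (⌊(n : ℝ) / 4⌋₊.factorial : ℝ) * Real.exp (-(n / 4))) ≤
      27 / 10 := by
  have he := Real.exp_one_lt_d9
  have hfl : ⌊(n : ℝ) / 4⌋₊ = n / 4 := by exact_mod_cast Nat.floor_div_eq_div (K := ℝ) n 4
  rw [hfl]
  rcases lt_or_ge n 4 with h4 | h4
  · have hpow : ∀ (a b : ℝ) (k : ℕ), 0 ≤ b → Real.exp 1 ^ k ≤ b ^ 4 → a * 4 = k →
        Real.exp a ≤ b := fun a b k hb h hk => by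
      refine le_of_pow_le_pow_left₀ (n := 4) (by norm_num) hb ?_
      rw [← Real.exp_nat_mul] at h ⊢
      push_cast
      rwa [mul_comm 4 a, hk, ← mul_one (k : ℝ)]
    have hb : ∀ k : ℕ, Real.exp 1 ^ k ≤ 2.72 ^ k := fun k => by gcongr; linarith
    interval_cases n
    · have := hpow (3 / 4) 2.7 3 (by norm_num) ((hb 3).trans (by norm_num)) (by norm_num)
      have e : Real.exp 1 * Real.exp (-(1 / 4)) = Real.exp (3 / 4) := by
        rw [← Real.exp_add]; norm_num
      norm_num [Nat.factorial] at *
      linarith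
    · have := hpow (3 / 2) 5.4 6 (by norm_num) ((hb 6).trans (by norm_num)) (by norm_num)
      have e : Real.exp 2 * Real.exp (-(1 / 2)) = Real.exp (3 / 2) := by
        rw [← Real.exp_add]; norm_num
      norm_num [Nat.factorial] at *
      linarith
    · have := hpow (9 / 4) 12.15 9 (by norm_num) ((hb 9).trans (by norm_num)) (by norm_num)
      have e : Real.exp 3 * Real.exp (-(3 / 4)) = Real.exp (9 / 4) := by
        rw [← Real.exp_add]; norm_num
      norm_num [Nat.factorial] at *
      linarith
  · have hm : 0 < n / 4 := by omega
    have h7 : (n : ℝ) ≤ 7 * (n / 4 : ℕ) := by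
      exact_mod_cast (show n ≤ 7 * (n / 4) by omega)
    have hs := stirlingSeq_le hm (Nat.div_le_self n 4)
    have hp := pow_mul_exp_neg_le (l := (n : ℝ) / 4) (by positivity) hm
    have hf := factorial_eq_stirlingSeq hm
    set m := n / 4
    have hm' : (0 : ℝ) < m := by positivity
    have hspos : 0 < Stirling.stirlingSeq m := by
      obtain ⟨a, ha⟩ := Nat.exists_eq_succ_of_ne_zero hm.ne'
      rw [ha]; exact Stirling.stirlingSeq'_pos a
    have hsq : Real.sqrt n ≤ 27 / 10 * Real.sqrt m := by
      rw [Real.sqrt_le_iff]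
      refine ⟨by positivity, ?_⟩
      rw [mul_pow, Real.sq_sqrt hm'.le]
      linarith
    have h1 : (n.factorial : ℝ) * (Real.exp n / n ^ n) =
        Stirling.stirlingSeq n * (Real.sqrt n * Real.sqrt 2) := by
      rw [factorial_eq_stirlingSeq hn, Real.exp_neg]
      have := (Real.exp_pos n).ne'
      field_simp
    rw [h1]
    have h2 : Stirling.stirlingSeq n * (Real.sqrt n * Real.sqrt 2) ≤
        Stirling.stirlingSeq m * ((27 / 10 * Real.sqrt m) * Real.sqrt 2) := by gcongr
    have h3 : ((n : ℝ) / 4) ^ m / (m.factorial : ℝ) * Real.exp (-(n / 4)) ≤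
        (m ^ m * Real.exp (-m)) / (m.factorial : ℝ) := by
      rw [div_mul_eq_mul_div]; gcongr
    calc _ ≤ Stirling.stirlingSeq m * ((27 / 10 * Real.sqrt m) * Real.sqrt 2) *
          ((m ^ m * Real.exp (-m)) / (m.factorial : ℝ)) := by gcongr
      _ = 27 / 10 := by
        rw [hf]
        have := (Real.exp_pos (-(m : ℝ))).ne'
        have : Real.sqrt m ≠ 0 := by positivity
        field_simp

lemma binomialPoissonRatio_three_quarters_le {n : ℕ} (hn : 0 < n) {r : ℕ} (hr : r ≤ n) :
    binomialPoissonRatio n (3 / 4) r ≤ 27 / 10 := by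
  refine le_trans ?_ (factorial_mul_exp_mul_poisson_le hn)
  have hpos : (0 : ℝ) < n := by positivity
  refine le_trans (le_of_eq ?_) (mul_le_mul_of_nonneg_left (mul_le_mul_of_nonneg_right
    (pow_div_factorial_le_floor (l := (n : ℝ) / 4) (by positivity) (n - r)) (Real.exp_pos _).le)
    (by positivity))
  have hd : ((n - r).factorial : ℝ) * n.descFactorial r = n.factorial := by
    exact_mod_cast Nat.factorial_mul_descFactorial hr
  rw [← hd, binomialPoissonRatio]
  have he : Real.exp (n * (3 / 4)) = Real.exp n * Real.exp (-(n / 4)) := by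
    rw [← Real.exp_add]; congr 1; ring
  have hn' : (n : ℝ) ^ n = n ^ (n - r) * n ^ r := by rw [← pow_add, Nat.sub_add_cancel hr]
  rw [he, hn', div_pow, show (1 - 3 / 4 : ℝ) = 1 / 4 by norm_num, div_pow, one_pow]
  have : ((n - r).factorial : ℝ) ≠ 0 := by positivity
  field_simp

lemma binomialMass_nonneg (n : ℕ) {q : ℝ} (h0 : 0 ≤ q) (h1 : q ≤ 1) (r : ℕ) :
    0 ≤ binomialMass n q r := by
  have : 0 ≤ 1 - q := by linarith
  unfold binomialMass; positivity

/-- The `χ²`-divergence of the binomial law from the Poisson law of the same mean is quadratic in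
the success probability. -/
lemma sum_binomialMass_mul_ratio_le {n : ℕ} (hn : 0 < n) {q : ℝ} (h0 : 0 ≤ q) (h1 : q ≤ 3 / 4) :
    ∑ r ∈ range (n + 1), binomialMass n q r * binomialPoissonRatio n q r - 1 ≤
      (q / (3 / 4)) ^ 2 * (17 / 10) := by
  have hn' : (n : ℝ) ≠ 0 := by positivity
  have hdeg : (poissonKernelPoly n).natDegree ≤ n := by
    refine (natDegree_C_mul_le _ _).trans ?_
    rw [natDegree_pow, natDegree_X_sub_C, mul_one]
  have hinv : (-1 / (n : ℝ)) * -n = 1 := by field_simp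
  have hev : (poissonKernelPoly n).eval 0 = 1 := by
    simp only [poissonKernelPoly, eval_mul, eval_C, eval_pow, eval_sub, eval_X, zero_sub]
    rw [← mul_pow, hinv, one_pow]
  have hev' : (poissonKernelPoly n + derivative (poissonKernelPoly n)).eval 0 = 0 := by
    have hd : (derivative (poissonKernelPoly n)).eval 0 = -1 := by
      rw [poissonKernelPoly, derivative_C_mul, derivative_X_sub_C_pow]
      simp only [eval_mul, eval_C, eval_pow, eval_sub, eval_X, zero_sub]
      obtain ⟨k, hk⟩ := Nat.exists_eq_succ_of_ne_zero hn.ne'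
      have hk' : n - 1 = k := by omega
      rw [hk', show (-1 / (n : ℝ)) ^ n = (-1 / (n : ℝ)) ^ k * (-1 / (n : ℝ)) by
        rw [← pow_succ]; congr 1]
      calc _ = ((-1 / (n : ℝ)) * -n) ^ k * (-((-1 / (n : ℝ)) * -n)) := by rw [mul_pow]; ring
        _ = -1 := by rw [hinv, one_pow, one_mul]
    rw [eval_add, hev, hd]; norm_num
  have h := exp_mul_derivSqSum_scale_le hdeg hev' (c := q / (3 / 4)) (x := n * (3 / 4))
    (by positivity) ((div_le_one (by norm_num)).2 h1) (by positivity)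
  rw [show q / (3 / 4) * (n * (3 / 4)) = n * q by ring, exp_mul_derivSqSum_poissonKernelPoly hn,
    exp_mul_derivSqSum_poissonKernelPoly hn, hev, one_pow] at h
  refine h.trans (mul_le_mul_of_nonneg_left ?_ (by positivity))
  have hb : ∑ r ∈ range (n + 1), binomialMass n (3 / 4) r * binomialPoissonRatio n (3 / 4) r ≤
      ∑ r ∈ range (n + 1), binomialMass n (3 / 4) r * (27 / 10) := by
    refine sum_le_sum fun r hr => mul_le_mul_of_nonneg_left
      (binomialPoissonRatio_three_quarters_le hn (by simpa [Nat.lt_succ_iff] using hr))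
      (binomialMass_nonneg n (by norm_num) (by norm_num) r)
  rw [← sum_mul, sum_binomialMass le_rfl] at hb
  linarith

lemma sum_poissonMass_mul_one_sub_ratio_sq_le {n : ℕ} (hn : 0 < n) {q : ℝ} (h0 : 0 ≤ q)
    (h1 : q ≤ 3 / 4) (N : ℕ) :
    ∑ r ∈ range N, poissonMass (n * q) r * (1 - binomialPoissonRatio n q r) ^ 2 ≤
      (q / (3 / 4)) ^ 2 * (17 / 10) := by
  have hnq : (0 : ℝ) ≤ n * q := by positivity
  set M := max N (n + 1)
  have hM : n + 1 ≤ M := le_max_right _ _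
  calc _ ≤ ∑ r ∈ range M, poissonMass (n * q) r * (1 - binomialPoissonRatio n q r) ^ 2 :=
        sum_le_sum_of_subset_of_nonneg (range_subset_range.2 (le_max_left _ _)) fun r _ _ =>
          mul_nonneg (poissonMass_nonneg hnq r) (sq_nonneg _)
    _ = ∑ r ∈ range M, poissonMass (n * q) r - 2 * ∑ r ∈ range M, binomialMass n q r +
          ∑ r ∈ range M, binomialMass n q r * binomialPoissonRatio n q r := by
        rw [mul_sum, ← sum_sub_distrib, ← sum_add_distrib]
        refine sum_congr rfl fun r _ => ?_
        rw [← poissonMass_mul_ratio hn]; ring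
    _ ≤ _ := by
        have e : ∑ r ∈ range M, binomialMass n q r * binomialPoissonRatio n q r =
            ∑ r ∈ range (n + 1), binomialMass n q r * binomialPoissonRatio n q r := by
          refine (sum_subset (range_subset_range.2 hM) fun r _ hr => ?_).symm
          simp only [mem_range, not_lt] at hr
          simp [binomialMass, Nat.choose_eq_zero_of_lt (show n < r by omega)]
        rw [e, sum_binomialMass hM]
        linarith [sum_poissonMass_le_one hnq M, sum_binomialMass_mul_ratio_le hn h0 h1]

/-- Comparison of binomial and Poisson expectations of a `[0, 1]`-valued function. -/
lemma sum_poissonMass_mul_sub_le {n : ℕ} (hn : 0 < n) {q : ℝ} (h0 : 0 ≤ q) (h1 : q ≤ 3 / 4)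
    (N : ℕ) {f : ℕ → ℝ} (hf0 : ∀ r ∈ range N, 0 ≤ f r) (hf1 : ∀ r ∈ range N, f r ≤ 1) :
    ∑ r ∈ range N, poissonMass (n * q) r * f r - ∑ r ∈ range N, binomialMass n q r * f r ≤
      9 / 5 * q * Real.sqrt (∑ r ∈ range N, poissonMass (n * q) r * f r) := by
  have hp := poissonMass_nonneg (l := n * q) (by positivity)
  have hS : 0 ≤ ∑ r ∈ range N, poissonMass (n * q) r * f r :=
    sum_nonneg fun r hr => mul_nonneg (hp r) (hf0 r hr)
  rw [← sum_sub_distrib]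
  refine le_of_sq_le_sq ?_ (by positivity)
  have cs := sum_mul_sq_le_sq_mul_sq (range N)
    (fun r => Real.sqrt (poissonMass (n * q) r) * f r)
    (fun r => Real.sqrt (poissonMass (n * q) r) * (1 - binomialPoissonRatio n q r))
  simp only [mul_pow, Real.sq_sqrt (hp _)] at cs
  have e : ∀ r, Real.sqrt (poissonMass (n * q) r) * f r * (Real.sqrt (poissonMass (n * q) r) *
      (1 - binomialPoissonRatio n q r)) =
      poissonMass (n * q) r * f r - binomialMass n q r * f r := fun r => by
    rw [mul_mul_mul_comm, Real.mul_self_sqrt (hp r), ← poissonMass_mul_ratio hn]; ring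
  simp only [e] at cs
  refine cs.trans ?_
  rw [mul_pow, Real.sq_sqrt hS, mul_comm]
  refine mul_le_mul ?_ ?_ (sum_nonneg fun r _ => mul_nonneg (hp r) (sq_nonneg _)) (by positivity)
  · refine (sum_poissonMass_mul_one_sub_ratio_sq_le hn h0 h1 N).trans ?_
    nlinarith [sq_nonneg q]
  · refine sum_le_sum fun r hr => mul_le_mul_of_nonneg_left ?_ (hp r)
    nlinarith [hf0 r hr, hf1 r hr]

lemma tsum_ite_lt_eq_sum_range (g : ℕ → ℝ) (x : ℝ) :
    ∑' i : ℕ, (if (i : ℝ) < x then g i else 0) = ∑ i ∈ range ⌈x⌉₊, g i := by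
  rw [tsum_eq_sum (s := range ⌈x⌉₊)]
  · exact sum_congr rfl fun i hi => if_pos (Nat.lt_ceil.1 (mem_range.1 hi))
  · intro i hi
    exact if_neg fun h => hi (mem_range.2 (Nat.lt_ceil.2 h))

/-- Converse half of the non-asymptotic coding bound for the low-capacity BEC:
if `M₂ > 1` satisfies `𝔓₂ − α√𝔓₂ − α√(P_κ(log₂ M₂)) = p_e` with `𝔓₂ ≥ 0`, then the
converse-bound sum is at least `p_e`. -/
theorem bec_low_capacity_converse (n : ℕ) (hn : 0 < n) (ε : ℝ) (hε0 : 0 < ε)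
    (hε1 : ε < 1) (κ : ℝ) (hκ : κ = (n : ℝ) * (1 - ε)) (pe : ℝ) (hpe0 : 0 < pe)
    (hpe1 : pe < 1) (α : ℝ)
    (hα : α = Real.sqrt 2 / ε ^ ((3 : ℝ) / 2) * (1 + 2 * Real.sqrt (3 / (ε * κ))) *
      (Real.sqrt (Real.exp 1) - 1) * (1 - ε))
    (M₂ : ℝ) (hM₂ : 1 < M₂) (P₂ : ℝ)
    (hP₂ : P₂ = poissonCDF κ (Real.logb 2 M₂) -
      Real.exp κ / M₂ * poissonCDF (2 * κ) (Real.logb 2 M₂))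
    (hP₂pos : 0 ≤ P₂)
    (heq : P₂ - α * Real.sqrt P₂ - α * Real.sqrt (poissonCDF κ (Real.logb 2 M₂)) = pe) :
    pe ≤ ∑' r : ℕ, (if (r : ℝ) < Real.logb 2 M₂ then
        (n.choose r : ℝ) * ε ^ (n - r) * (1 - ε) ^ r * (1 - 2 ^ r / M₂) else 0) := by
  have hq0 : 0 < 1 - ε := by linarith
  have hn' : (0 : ℝ) < n := by positivity
  have hκ0 : 0 < κ := hκ ▸ mul_pos hn' hq0
  have hM0 : 0 < M₂ := by linarith
  set N := ⌈Real.logb 2 M₂⌉₊ with hN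
  set f : ℕ → ℝ := fun r => 1 - 2 ^ r / M₂ with hf
  have hA : poissonCDF κ (Real.logb 2 M₂) = ∑ r ∈ range N, poissonMass κ r :=
    tsum_ite_lt_eq_sum_range (poissonMass κ) _
  have hB : poissonCDF (2 * κ) (Real.logb 2 M₂) = ∑ r ∈ range N, poissonMass (2 * κ) r :=
    tsum_ite_lt_eq_sum_range (poissonMass (2 * κ)) _
  have hf0 : ∀ r ∈ range N, 0 ≤ f r := fun r hr => by
    have h1 : (r : ℝ) < Real.logb 2 M₂ := Nat.lt_ceil.1 (mem_range.1 hr)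
    rw [Real.lt_logb_iff_rpow_lt (by norm_num) hM0, Real.rpow_natCast] at h1
    exact sub_nonneg.2 ((div_le_one hM0).2 h1.le)
  have hf1 : ∀ r ∈ range N, f r ≤ 1 := fun r _ => sub_le_self _ (by positivity)
  have hP : P₂ = ∑ r ∈ range N, poissonMass κ r * f r := by
    rw [hP₂, hA, hB, mul_sum, ← sum_sub_distrib]
    refine sum_congr rfl fun r _ => ?_
    have he : Real.exp (-(2 * κ)) = Real.exp (-κ) * (Real.exp κ)⁻¹ := by
      rw [← Real.exp_neg, ← Real.exp_add]; congr 1; ring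
    have := (Real.exp_pos κ).ne'
    simp only [poissonMass, hf]
    rw [he, mul_pow]
    field_simp
  have hgoal : ∑' r : ℕ, (if (r : ℝ) < Real.logb 2 M₂ then
      (n.choose r : ℝ) * ε ^ (n - r) * (1 - ε) ^ r * (1 - 2 ^ r / M₂) else 0) =
      ∑ r ∈ range N, binomialMass n (1 - ε) r * f r := by
    rw [tsum_ite_lt_eq_sum_range
      (fun r => (n.choose r : ℝ) * ε ^ (n - r) * (1 - ε) ^ r * (1 - 2 ^ r / M₂))]
    simp only [binomialMass, sub_sub_cancel, hf, hN]
  rw [hgoal]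
  set A := poissonCDF κ (Real.logb 2 M₂)
  have hA1 : A ≤ 1 := hA ▸ sum_poissonMass_le_one hκ0.le N
  have hPA : P₂ ≤ A := by
    rw [hP, hA]
    exact sum_le_sum fun r hr =>
      mul_le_of_le_one_right (poissonMass_nonneg hκ0.le r) (hf1 r hr)
  have hsq : Real.sqrt P₂ ≤ Real.sqrt A := Real.sqrt_le_sqrt hPA
  have hα1 : 9 / 10 * (1 - ε) ≤ α := by
    rw [hα]
    have h2 : 1.41 ≤ Real.sqrt 2 := Real.le_sqrt_of_sq_le (by norm_num)
    have he : 1.64 ≤ Real.sqrt (Real.exp 1) :=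
      Real.le_sqrt_of_sq_le (by linarith [Real.exp_one_gt_d9])
    have h3 : 1.41 ≤ Real.sqrt 2 / ε ^ ((3 : ℝ) / 2) :=
      h2.trans (le_div_self (Real.sqrt_nonneg 2) (by positivity)
        (Real.rpow_le_one hε0.le hε1.le (by norm_num)))
    have h4 : 1 ≤ 1 + 2 * Real.sqrt (3 / (ε * κ)) := by
      linarith [Real.sqrt_nonneg (3 / (ε * κ))]
    refine mul_le_mul_of_nonneg_right ?_ hq0.le
    calc (9 / 10 : ℝ) ≤ 1.41 * 1 * 0.64 := by norm_num
      _ ≤ _ := by gcongr; linarith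
  have hα0 : 0 ≤ α := by linarith
  have hαsq := mul_le_mul_of_nonneg_left hsq hα0
  have hα2 : α ≤ 1 / 2 := by
    by_contra! h
    have hs0 := Real.sqrt_nonneg P₂
    have hs1 : Real.sqrt P₂ ≤ 1 := Real.sqrt_le_one.2 (hPA.trans hA1)
    nlinarith [Real.sq_sqrt hP₂pos]
  have key := sum_poissonMass_mul_sub_le hn hq0.le (by linarith) N hf0 hf1
  rw [← hκ, ← hP] at key
  have := mul_le_mul_of_nonneg_right hα1 (Real.sqrt_nonneg P₂)
  linarith
end

section
/- Let γ ∈ (0,1) and z > 0 be real numbers satisfying 1 − γz = e^{-z}. Then 2(1−γ) ≤ z ≤ 2(1−γ)/γ². -/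
theorem Real.exp_neg_le_quadratic {x : ℝ} (hx : 0 ≤ x) :
    Real.exp (-x) ≤ 1 - x + x ^ 2 / 2 := by
  have hq := Real.quadratic_le_exp_of_nonneg hx
  have hp : 0 < 1 - x + x ^ 2 / 2 := by nlinarith [sq_nonneg (x - 1)]
  rw [Real.exp_neg, inv_le_iff_one_le_mul₀ (Real.exp_pos x)]
  calc (1 : ℝ) ≤ (1 - x + x ^ 2 / 2) * (1 + x + x ^ 2 / 2) := by nlinarith [sq_nonneg (x ^ 2)]
    _ ≤ (1 - x + x ^ 2 / 2) * Real.exp x := by gcongr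

theorem Real.add_sq_div_two_le_neg_log_one_sub {u : ℝ} (hu0 : 0 ≤ u) (hu1 : u < 1) :
    u + u ^ 2 / 2 ≤ -Real.log (1 - u) := by
  have hs := Real.hasSum_pow_div_log_of_abs_lt_one (abs_lt.2 ⟨by linarith, hu1⟩)
  have h := sum_le_hasSum (Finset.range 2) (fun i _ => by positivity) hs
  norm_num [Finset.sum_range_succ] at h
  linarith

/-- If `γ ∈ (0,1)` and `z > 0` satisfy `1 − γz = e^{-z}`, then
`2(1−γ) ≤ z ≤ 2(1−γ)/γ²`. -/
theorem repetition_fixed_point_bounds (γ z : ℝ) (hγ0 : 0 < γ) (hγ1 : γ < 1) (hz : 0 < z)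
    (heq : 1 - γ * z = Real.exp (-z)) :
    2 * (1 - γ) ≤ z ∧ z ≤ 2 * (1 - γ) / γ ^ 2 := by
  constructor
  · have h := Real.exp_neg_le_quadratic hz.le
    refine le_of_mul_le_mul_right ?_ hz
    linarith
  · have hu1 : γ * z < 1 := by linarith [Real.exp_pos (-z)]
    have h := Real.add_sq_div_two_le_neg_log_one_sub (mul_pos hγ0 hz).le hu1
    rw [heq, Real.log_exp, neg_neg] at h
    rw [le_div_iff₀ (by positivity)]
    refine le_of_mul_le_mul_right ?_ hz
    linarith
end

section
/- Let h₂(x) = −x log₂ x − (1−x) log₂(1−x) be the binary entropy function. There exist δ₀ ∈ (0, 1/2) and K > 0 such that for all δ ∈ (δ₀, 1/2), writing C = 1 − h₂(δ), one has | (1/2 − δ) − √((ln 2)/2 · C) | ≤ K · C^{3/2}. -/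
/-- The binary entropy function `h₂(x) = −x log₂ x − (1−x) log₂(1−x)`. -/
noncomputable def binEntropy (x : ℝ) : ℝ :=
  -x * Real.logb 2 x - (1 - x) * Real.logb 2 (1 - x)

/-- Second-order expansion of `(1 + y) log (1 + y) + (1 - y) log (1 - y)` at `0`. -/
theorem abs_one_add_mul_log_add_one_sub_mul_log_sub_sq_le {y : ℝ} (hy : |y| ≤ 1 / 2) :
    |(1 + y) * Real.log (1 + y) + (1 - y) * Real.log (1 - y) - y ^ 2| ≤ 5 * y ^ 4 := by
  have hrem : |y| ^ (3 + 1) / (1 - |y|) ≤ 2 * y ^ 4 := by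
    rw [div_le_iff₀ (by linarith), Even.pow_abs (by decide)]
    norm_num
    nlinarith [mul_nonneg (Even.pow_nonneg (by decide : Even 4) y) (by linarith : 0 ≤ 1 / 2 - |y|)]
  have hrem' : |(-y)| ^ (3 + 1) / (1 - |(-y)|) ≤ 2 * y ^ 4 := by rwa [abs_neg]
  have h₁ := (Real.abs_log_sub_add_sum_range_le (x := y) (by linarith) 3).trans hrem
  have h₂ := (Real.abs_log_sub_add_sum_range_le (x := -y) (by rw [abs_neg]; linarith) 3).trans hrem'
  norm_num [Finset.sum_range_succ] at h₁ h₂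
  rw [abs_le] at h₁ h₂ hy ⊢
  obtain ⟨h₁l, h₁u⟩ := h₁
  obtain ⟨h₂l, h₂u⟩ := h₂
  have hp : 0 ≤ 1 + y := by linarith
  have hm : 0 ≤ 1 - y := by linarith
  have h4 : 0 ≤ y ^ 4 := by positivity
  constructor
  · linarith [mul_le_mul_of_nonneg_left h₁l hm, mul_le_mul_of_nonneg_left h₂l hp]
  · linarith [mul_le_mul_of_nonneg_left h₁u hm, mul_le_mul_of_nonneg_left h₂u hp]

/-- The capacity of a binary symmetric channel in terms of the bias `y = 1 - 2δ`. -/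
theorem log_two_mul_one_sub_binEntropy {y : ℝ} (h₁ : -1 < y) (h₂ : y < 1) :
    Real.log 2 * (1 - binEntropy ((1 - y) / 2)) =
      ((1 + y) * Real.log (1 + y) + (1 - y) * Real.log (1 - y)) / 2 := by
  have hlog : Real.log 2 ≠ 0 := (Real.log_pos one_lt_two).ne'
  have hsub : 1 - (1 - y) / 2 = (1 + y) / 2 := by ring
  rw [binEntropy, hsub, Real.logb, Real.logb, Real.log_div (by linarith) two_ne_zero,
    Real.log_div (by linarith) two_ne_zero]
  field_simp
  ring

theorem abs_sub_sqrt_le {t a : ℝ} (ht : 0 < t) (ha : 0 ≤ a) :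
    |t - Real.sqrt a| ≤ |a - t ^ 2| / t := by
  have hs := Real.sqrt_nonneg a
  rw [le_div_iff₀ ht, abs_sub_comm a, show t ^ 2 - a = (t - Real.sqrt a) * (t + Real.sqrt a) by
    linear_combination Real.sq_sqrt ha, abs_mul, abs_of_pos (by linarith : 0 < t + Real.sqrt a)]
  exact mul_le_mul_of_nonneg_left (by linarith) (abs_nonneg _)

/-- There exist `δ₀ ∈ (0, 1/2)` and `K > 0` such that for all `δ ∈ (δ₀, 1/2)`, writing
`C = 1 − h₂(δ)`, one has `|(1/2 − δ) − √((ln 2)/2 · C)| ≤ K·C^{3/2}`. -/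
theorem bsc_crossover_capacity_estimate :
    ∃ δ₀ K : ℝ, 0 < δ₀ ∧ δ₀ < 1 / 2 ∧ 0 < K ∧
      ∀ δ : ℝ, δ₀ < δ → δ < 1 / 2 →
        |(1 / 2 - δ) - Real.sqrt (Real.log 2 / 2 * (1 - binEntropy δ))| ≤
          K * (1 - binEntropy δ) ^ ((3 : ℝ) / 2) := by
  refine ⟨3 / 8, 20, by norm_num, by norm_num, by norm_num, fun δ hδ₁ hδ₂ => ?_⟩
  obtain ⟨y, rfl⟩ : ∃ y, δ = (1 - y) / 2 := ⟨1 - 2 * δ, by ring⟩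
  have hy : 0 < y := by linarith
  have hy' : y < 1 / 4 := by linarith
  have hC := log_two_mul_one_sub_binEntropy (by linarith : -1 < y) (by linarith)
  have hG := abs_one_add_mul_log_add_one_sub_mul_log_sub_sq_le
    (abs_le.2 ⟨by linarith, by linarith⟩ : |y| ≤ 1 / 2)
  set C := 1 - binEntropy ((1 - y) / 2)
  set G := (1 + y) * Real.log (1 + y) + (1 - y) * Real.log (1 - y)
  have hlog : 0 < Real.log 2 := Real.log_pos one_lt_two
  have hlog' : Real.log 2 < 1 := Real.log_two_lt_d9.trans (by norm_num)
  have hy4 : y ^ 4 ≤ y ^ 2 / 16 := by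
    nlinarith [mul_nonneg (sq_nonneg y) (by nlinarith : 0 ≤ 1 / 16 - y ^ 2)]
  have hG' : y ^ 2 / 2 ≤ G := by nlinarith [(abs_le.1 hG).1, sq_nonneg y]
  have hC₀ : 0 ≤ C := by
    refine nonneg_of_mul_nonneg_right ?_ hlog
    nlinarith [sq_nonneg y]
  have hC₁ : (y / 2) ^ 2 ≤ C := by nlinarith
  have hpow : (y / 2) ^ 3 ≤ C ^ ((3 : ℝ) / 2) := by
    calc (y / 2) ^ 3 = ((y / 2) ^ 2) ^ ((3 : ℝ) / 2) := by
          rw [← Real.rpow_natCast, ← Real.rpow_natCast, ← Real.rpow_mul (by positivity)]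
          norm_num
      _ ≤ C ^ ((3 : ℝ) / 2) := Real.rpow_le_rpow (by positivity) hC₁ (by norm_num)
  have hA : Real.log 2 / 2 * C - (y / 2) ^ 2 = (G - y ^ 2) / 4 := by linarith
  calc |1 / 2 - (1 - y) / 2 - Real.sqrt (Real.log 2 / 2 * C)|
      = |y / 2 - Real.sqrt (Real.log 2 / 2 * C)| := by ring_nf
    _ ≤ |(G - y ^ 2) / 4| / (y / 2) := hA ▸ abs_sub_sqrt_le (by linarith) (by positivity)
    _ ≤ 20 * (y / 2) ^ 3 := by
        rw [div_le_iff₀ (by linarith), abs_div, abs_of_pos (by norm_num : (0 : ℝ) < 4)]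
        linarith
    _ ≤ 20 * C ^ ((3 : ℝ) / 2) := by linarith
end

section
/- Let h₂(x) = −x log₂ x − (1−x) log₂(1−x) be the binary entropy function. There exist δ₀ ∈ (0, 1/2) and K > 0 such that for all δ ∈ (δ₀, 1/2), writing C = 1 − h₂(δ), one has | log₂((1−δ)/δ) − 2√(2C/ln 2) | ≤ K · C^{3/2}. -/
theorem nonneg_of_hasDerivAt_nonneg {f f' : ℝ → ℝ} {b : ℝ} (h0 : f 0 = 0)
    (hf : ∀ x, 0 ≤ x → x < b → HasDerivAt f (f' x) x)
    (hf' : ∀ x, 0 ≤ x → x < b → 0 ≤ f' x) {t : ℝ} (ht : 0 ≤ t) (htb : t < b) : 0 ≤ f t := by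
  have hmono : MonotoneOn f (Set.Ico 0 b) := by
    refine monotoneOn_of_deriv_nonneg (convex_Ico 0 b)
      (fun x hx => (hf x hx.1 hx.2).continuousAt.continuousWithinAt) ?_ ?_
    · intro x hx
      have hx := interior_subset hx
      exact (hf x hx.1 hx.2).differentiableAt.differentiableWithinAt
    · intro x hx
      have hx := interior_subset hx
      rw [(hf x hx.1 hx.2).deriv]
      exact hf' x hx.1 hx.2
  have h := hmono ⟨le_rfl, ht.trans_lt htb⟩ ⟨ht, htb⟩ ht
  rwa [h0] at h

theorem hasDerivAt_log_one_add {x : ℝ} (hx : 0 < 1 + x) :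
    HasDerivAt (fun y => Real.log (1 + y)) (1 / (1 + x)) x :=
  ((hasDerivAt_id x).const_add 1).log hx.ne'

theorem hasDerivAt_log_one_sub {x : ℝ} (hx : 0 < 1 - x) :
    HasDerivAt (fun y => Real.log (1 - y)) (-1 / (1 - x)) x :=
  ((hasDerivAt_id x).const_sub 1).log hx.ne'

theorem two_mul_le_log_one_add_sub_log_one_sub {t : ℝ} (ht : 0 ≤ t) (ht1 : t < 1 / 2) :
    2 * t ≤ Real.log (1 + t) - Real.log (1 - t) := by
  have h := nonneg_of_hasDerivAt_nonneg (b := 1 / 2)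
    (f := fun x => Real.log (1 + x) - Real.log (1 - x) - 2 * x)
    (f' := fun x => 1 / (1 + x) - -1 / (1 - x) - 2 * 1) (by simp)
    (fun x h0 h1 => ((hasDerivAt_log_one_add (by linarith)).sub
      (hasDerivAt_log_one_sub (by linarith))).sub ((hasDerivAt_id x).const_mul 2))
    (fun x h0 h1 => ?_) ht ht1
  · linarith
  · have ha : 0 < 1 + x := by linarith
    have hb : 0 < 1 - x := by linarith
    have e : 1 / (1 + x) - -1 / (1 - x) - 2 * 1 = 2 * x ^ 2 / ((1 + x) * (1 - x)) := by
      field_simp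
      ring
    rw [e]
    positivity

theorem log_one_add_sub_log_one_sub_le {t : ℝ} (ht : 0 ≤ t) (ht1 : t < 1 / 2) :
    Real.log (1 + t) - Real.log (1 - t) ≤ 2 * t + t ^ 3 := by
  have h := nonneg_of_hasDerivAt_nonneg (b := 1 / 2)
    (f := fun x => 2 * x + x ^ 3 - (Real.log (1 + x) - Real.log (1 - x)))
    (f' := fun x => 2 * 1 + (3 : ℕ) * x ^ 2 - (1 / (1 + x) - -1 / (1 - x))) (by simp)
    (fun x h0 h1 => (((hasDerivAt_id x).const_mul 2).add (hasDerivAt_pow 3 x)).sub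
      ((hasDerivAt_log_one_add (by linarith)).sub (hasDerivAt_log_one_sub (by linarith))))
    (fun x h0 h1 => ?_) ht ht1
  · linarith
  · have ha : 0 < 1 + x := by linarith
    have hb : 0 < 1 - x := by linarith
    have e : 2 * 1 + (3 : ℕ) * x ^ 2 - (1 / (1 + x) - -1 / (1 - x)) =
        x ^ 2 * (1 - 3 * x ^ 2) / ((1 + x) * (1 - x)) := by
      push_cast
      field_simp
      ring
    rw [e]
    have hc : 0 ≤ 1 - 3 * x ^ 2 := by nlinarith
    positivity

theorem hasDerivAt_one_add_mul_log_add_one_sub_mul_log {x : ℝ} (ha : 0 < 1 + x) (hb : 0 < 1 - x) :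
    HasDerivAt (fun y => (1 + y) * Real.log (1 + y) + (1 - y) * Real.log (1 - y))
      (Real.log (1 + x) - Real.log (1 - x)) x := by
  refine ((((hasDerivAt_id x).const_add 1).mul (hasDerivAt_log_one_add ha)).add
    (((hasDerivAt_id x).const_sub 1).mul (hasDerivAt_log_one_sub hb))).congr_deriv ?_
  simp only [id]
  field_simp
  ring

theorem sq_le_one_add_mul_log_add_one_sub_mul_log {t : ℝ} (ht : 0 ≤ t) (ht1 : t < 1 / 2) :
    t ^ 2 ≤ (1 + t) * Real.log (1 + t) + (1 - t) * Real.log (1 - t) := by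
  have h := nonneg_of_hasDerivAt_nonneg (b := 1 / 2)
    (f := fun x => (1 + x) * Real.log (1 + x) + (1 - x) * Real.log (1 - x) - x ^ 2)
    (f' := fun x => Real.log (1 + x) - Real.log (1 - x) - (2 : ℕ) * x ^ 1) (by simp)
    (fun x h0 h1 => (hasDerivAt_one_add_mul_log_add_one_sub_mul_log
      (by linarith) (by linarith)).sub (hasDerivAt_pow 2 x))
    (fun x h0 h1 => ?_) ht ht1
  · linarith
  · have := two_mul_le_log_one_add_sub_log_one_sub h0 h1
    push_cast
    linarith

theorem one_add_mul_log_add_one_sub_mul_log_le {t : ℝ} (ht : 0 ≤ t) (ht1 : t < 1 / 2) :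
    (1 + t) * Real.log (1 + t) + (1 - t) * Real.log (1 - t) ≤ t ^ 2 + t ^ 4 / 4 := by
  have h := nonneg_of_hasDerivAt_nonneg (b := 1 / 2)
    (f := fun x => x ^ 2 + x ^ 4 / 4 -
      ((1 + x) * Real.log (1 + x) + (1 - x) * Real.log (1 - x)))
    (f' := fun x => (2 : ℕ) * x ^ 1 + (4 : ℕ) * x ^ 3 / 4 -
      (Real.log (1 + x) - Real.log (1 - x))) (by simp)
    (fun x h0 h1 => ((hasDerivAt_pow 2 x).add ((hasDerivAt_pow 4 x).div_const 4)).sub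
      (hasDerivAt_one_add_mul_log_add_one_sub_mul_log (by linarith) (by linarith)))
    (fun x h0 h1 => ?_) ht ht1
  · linarith
  · have := log_one_add_sub_log_one_sub_le h0 h1
    push_cast
    linarith

theorem one_sub_binEntropy_half_sub {t : ℝ} (ha : 0 < 1 + t) (hb : 0 < 1 - t) :
    1 - binEntropy ((1 - t) / 2) =
      ((1 + t) * Real.log (1 + t) + (1 - t) * Real.log (1 - t)) / (2 * Real.log 2) := by
  have h2 : Real.log 2 ≠ 0 := (Real.log_pos one_lt_two).ne'
  have e : 1 - (1 - t) / 2 = (1 + t) / 2 := by ring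
  rw [binEntropy, e, Real.logb, Real.logb, Real.log_div hb.ne' two_ne_zero,
    Real.log_div ha.ne' two_ne_zero]
  field_simp
  ring

/-- There exist `δ₀ ∈ (0, 1/2)` and `K > 0` such that for all `δ ∈ (δ₀, 1/2)`, writing
`C = 1 − h₂(δ)`, one has `|log₂((1−δ)/δ) − 2√(2C/ln 2)| ≤ K·C^{3/2}`. -/
theorem bsc_llr_capacity_estimate :
    ∃ δ₀ K : ℝ, 0 < δ₀ ∧ δ₀ < 1 / 2 ∧ 0 < K ∧
      ∀ δ : ℝ, δ₀ < δ → δ < 1 / 2 →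
        |Real.logb 2 ((1 - δ) / δ) - 2 * Real.sqrt (2 * (1 - binEntropy δ) / Real.log 2)| ≤
          K * (1 - binEntropy δ) ^ ((3 : ℝ) / 2) := by
  refine ⟨1 / 4, 16, by norm_num, by norm_num, by norm_num, fun δ hδ hδ' => ?_⟩
  obtain ⟨t, rfl⟩ : ∃ t, δ = (1 - t) / 2 := ⟨1 - 2 * δ, by ring⟩
  have ht : 0 < t := by linarith
  have ht1 : t < 1 / 2 := by linarith
  have ha : 0 < 1 + t := by linarith
  have hb : 0 < 1 - t := by linarith
  have hl : 1 / 2 < Real.log 2 := by linarith [Real.log_two_gt_d9]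
  have hl1 : Real.log 2 < 1 := by linarith [Real.log_two_lt_d9]
  have hl0 : 0 < Real.log 2 := by linarith
  have hL := two_mul_le_log_one_add_sub_log_one_sub ht.le ht1
  have hL' := log_one_add_sub_log_one_sub_le ht.le ht1
  have hD := sq_le_one_add_mul_log_add_one_sub_mul_log ht.le ht1
  have hD' := one_add_mul_log_add_one_sub_mul_log_le ht.le ht1
  have hratio : (1 - (1 - t) / 2) / ((1 - t) / 2) = (1 + t) / (1 - t) := by
    field_simp
    ring
  rw [one_sub_binEntropy_half_sub ha hb, hratio, Real.logb, Real.log_div ha.ne' hb.ne']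
  set L := Real.log (1 + t) - Real.log (1 - t)
  set D := (1 + t) * Real.log (1 + t) + (1 - t) * Real.log (1 - t)
  have hsqrt : Real.sqrt (2 * (D / (2 * Real.log 2)) / Real.log 2) =
      Real.sqrt D / Real.log 2 := by
    rw [show 2 * (D / (2 * Real.log 2)) / Real.log 2 = D / Real.log 2 ^ 2 by field_simp,
      Real.sqrt_div' _ (sq_nonneg _), Real.sqrt_sq hl0.le]
  have hs : t ≤ Real.sqrt D := Real.le_sqrt_of_sq_le hD
  have hs' : Real.sqrt D ≤ t + t ^ 3 / 8 := by
    refine Real.sqrt_le_iff.mpr ⟨by positivity, ?_⟩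
    nlinarith [sq_nonneg (t ^ 3)]
  have ht3 : 0 < t ^ 3 := by positivity
  have hnum : |L - 2 * Real.sqrt D| ≤ t ^ 3 := abs_le.mpr ⟨by linarith, by linarith⟩
  have hC : (t / 2) ^ 2 ≤ D / (2 * Real.log 2) := by
    rw [le_div_iff₀ (by positivity)]
    nlinarith [sq_nonneg t]
  have hpow : (t / 2) ^ 3 ≤ (D / (2 * Real.log 2)) ^ ((3 : ℝ) / 2) := by
    calc (t / 2) ^ 3 = ((t / 2) ^ 2) ^ ((3 : ℝ) / 2) := by
          rw [← Real.rpow_natCast_mul (by positivity), ← Real.rpow_natCast]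
          norm_num
      _ ≤ _ := Real.rpow_le_rpow (by positivity) hC (by norm_num)
  rw [hsqrt, ← mul_div_assoc, ← sub_div, abs_div, abs_of_pos hl0]
  calc |L - 2 * Real.sqrt D| / Real.log 2 ≤ t ^ 3 / (1 / 2) := by gcongr
    _ = 16 * (t / 2) ^ 3 := by ring
    _ ≤ _ := by gcongr
end

section
/- Let m and t be positive integers with 1 ≤ t ≤ m, and let z : ℕ → ℝ satisfy 0 ≤ z(j) ≤ 1 for all 0 ≤ j ≤ m. Suppose that 1 − z(j) ≤ 2(1 − z(j−1)) for every j ∈ {1, …, m} with j ≠ t, that 1 − z(t) ≤ 4(1 − z(t−1))², and that z(m) ≤ 1/2. Then for every real c > 0 with 1 − z(0) ≤ c, one has 2^{m−t+1} ≤ 4 · (2^{m} c)². -/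
/-- A sequence that at most doubles at each of `k` steps from `a` grows by a factor at most `2 ^ k`. -/
theorem le_two_pow_mul_of_doubling (y : ℕ → ℝ) (a k : ℕ)
    (h : ∀ i < k, y (a + i + 1) ≤ 2 * y (a + i)) : y (a + k) ≤ 2 ^ k * y a := by
  induction k with
  | zero => simp
  | succ k ih =>
    have hk := ih fun i hi => h i (by omega)
    have hs := h k (by omega)
    rw [← add_assoc, pow_succ]
    linarith

/-- Arithmetic conclusion of the implicit-repetition theorem for low-capacity polar codes:
under the Bhattacharyya recursion bounds, if the final synthetic channel is good
(`z(m) ≤ 1/2`) and `1 − z(0) ≤ c`, then `2^{m−t+1} ≤ 4·(2^m c)²`. -/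
theorem polar_implicit_repetition (m t : ℕ) (ht1 : 1 ≤ t) (htm : t ≤ m)
    (z : ℕ → ℝ) (hz : ∀ j ≤ m, 0 ≤ z j ∧ z j ≤ 1)
    (hplus : ∀ j, 1 ≤ j → j ≤ m → j ≠ t → 1 - z j ≤ 2 * (1 - z (j - 1)))
    (hminus : 1 - z t ≤ 4 * (1 - z (t - 1)) ^ 2)
    (hgood : z m ≤ 1 / 2) :
    ∀ c : ℝ, 0 < c → 1 - z 0 ≤ c → (2 : ℝ) ^ (m - t + 1) ≤ 4 * ((2 : ℝ) ^ m * c) ^ 2 := by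
  intro c hc hc0
  obtain ⟨s, rfl⟩ : ∃ s, t = s + 1 := ⟨t - 1, by omega⟩
  obtain ⟨d, rfl⟩ : ∃ d, m = s + 1 + d := ⟨m - (s + 1), by omega⟩
  have h_before := le_two_pow_mul_of_doubling (fun j => 1 - z j) 0 s fun i hi => by
    simpa using hplus (0 + i + 1) (by omega) (by omega) (by omega)
  have h_after := le_two_pow_mul_of_doubling (fun j => 1 - z j) (s + 1) d fun i hi => by
    simpa using hplus (s + 1 + i + 1) (by omega) (by omega) (by omega)
  simp only [zero_add, Nat.add_sub_cancel] at h_before h_after hminus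
  have hs0 : 0 ≤ 1 - z s := by linarith [(hz s (by omega)).2]
  have hs : 1 - z s ≤ 2 ^ s * c := h_before.trans (by gcongr)
  have hhalf : (1 : ℝ) / 2 ≤ 2 ^ d * (4 * (2 ^ s * c) ^ 2) := calc
    (1 : ℝ) / 2 ≤ 1 - z (s + 1 + d) := by linarith
    _ ≤ 2 ^ d * (1 - z (s + 1)) := h_after
    _ ≤ 2 ^ d * (4 * (1 - z s) ^ 2) := by gcongr
    _ ≤ 2 ^ d * (4 * (2 ^ s * c) ^ 2) := by gcongr
  rw [Nat.add_sub_cancel_left]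
  calc (2 : ℝ) ^ (d + 1) = 2 ^ d * 4 * (1 / 2) := by ring
    _ ≤ 2 ^ d * 4 * (2 ^ d * (4 * (2 ^ s * c) ^ 2)) := by gcongr
    _ = 4 * (2 ^ (s + 1 + d) * c) ^ 2 := by ring
end
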